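/- (Poincaré linearization in ℂ².) Let F be a holomorphic vector field on a neighborhood of 0 in ℂ² with F(0) = 0, and let A := DF(0) have eigenvalues λ₁, λ₂ forming a nonresonant spectral pair in the Poincaré domain. Then there exists a biholomorphism Ψ between neighborhoods of 0 in ℂ² with Ψ(0) = 0 and DΨ(0) = Id which conjugates the linear field to F, i.e. DΨ(w)·(A·w) = F(Ψ(w)) for all w near 0. If moreover A is semisimple, Ψ may be chosen so that the conjugated linear system is diagonal. -/

import Mathlib

/-- A spectral pair `(λ₁, λ₂)` lies in the Poincaré domain if `0` is not on the
closed segment between `λ₁` and `λ₂`. -/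
def PoincareDomain (l₁ l₂ : ℂ) : Prop := (0 : ℂ) ∉ segment ℝ l₁ l₂

/-- A spectral pair `(λ₁, λ₂)` is resonant if `λ_ι = α₁λ₁ + α₂λ₂` for some
`ι ∈ {1,2}` and nonnegative integers `α₁, α₂` with `α₁ + α₂ ≥ 2`. -/
def Resonant (l₁ l₂ : ℂ) : Prop :=
  ∃ α₁ α₂ : ℕ, 2 ≤ α₁ + α₂ ∧
    (l₁ = (α₁ : ℂ) * l₁ + (α₂ : ℂ) * l₂ ∨ l₂ = (α₁ : ℂ) * l₁ + (α₂ : ℂ) * l₂)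

namespace PL
open Finset.HasAntidiagonal

/-- multi-indices in two variables -/
abbrev Idx := Fin 2 →₀ ℕ

/-- The Wiener algebra: absolutely summable power series in two variables. -/
def WA : Type := lp (fun _ : Idx => ℂ) 1

noncomputable instance : NormedAddCommGroup WA :=
  inferInstanceAs (NormedAddCommGroup (lp (fun _ : Idx => ℂ) 1))
noncomputable instance : NormedSpace ℂ WA :=
  inferInstanceAs (NormedSpace ℂ (lp (fun _ : Idx => ℂ) 1))
instance : CompleteSpace WA :=
  inferInstanceAs (CompleteSpace (lp (fun _ : Idx => ℂ) 1))

/-- coefficients -/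
def co (a : WA) (n : Idx) : ℂ := a.1 n

lemma co_ext {a b : WA} (h : ∀ n, co a n = co b n) : a = b :=
  Subtype.ext (funext h)

lemma co_add (a b : WA) (n : Idx) : co (a + b) n = co a n + co b n := rfl
lemma co_sub (a b : WA) (n : Idx) : co (a - b) n = co a n - co b n := rfl
lemma co_zero (n : Idx) : co (0 : WA) n = 0 := rfl
lemma co_smul (c : ℂ) (a : WA) (n : Idx) : co (c • a) n = c * co a n := rfl

lemma summable_co (a : WA) : Summable (fun n => ‖co a n‖) := by
  have h := (lp.memℓp a)
  have := h.summable (by simp)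
  simp only [ENNReal.toReal_one, Real.rpow_one] at this
  exact this

lemma norm_WA (a : WA) : ‖a‖ = ∑' n, ‖co a n‖ := by
  have := lp.norm_eq_tsum_rpow (p := 1) (by simp) (a : lp (fun _ : Idx => ℂ) 1)
  simp only [ENNReal.toReal_one, Real.rpow_one, ne_eq, one_ne_zero, not_false_eq_true, div_self] at this
  exact this

/-- construct an element from a summable family -/
def mk (f : Idx → ℂ) (hf : Summable (fun n => ‖f n‖)) : WA :=
  ⟨f, memℓp_gen (by simpa using hf)⟩

lemma co_mk (f : Idx → ℂ) (hf) (n) : co (mk f hf) n = f n := rfl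

lemma norm_co_le (a : WA) (n : Idx) : ‖co a n‖ ≤ ‖a‖ := by
  rw [norm_WA]
  exact (summable_co a).le_tsum n (fun _ _ => norm_nonneg _)

lemma mul_aux {A : Type*} [AddCommMonoid A] [Finset.HasAntidiagonal A]
    (a b : A → ℂ) (ha : Summable fun n => ‖a n‖) (hb : Summable fun n => ‖b n‖) :
    Summable (fun n : A => ‖∑ kl ∈ antidiagonal n, a kl.1 * b kl.2‖) ∧
    ∑' n : A, ‖∑ kl ∈ antidiagonal n, a kl.1 * b kl.2‖ ≤ (∑' n, ‖a n‖) * ∑' n, ‖b n‖ := by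
  have h1 : Summable (fun x : A × A => ‖a x.1‖ * ‖b x.2‖) :=
    ha.mul_of_nonneg hb (fun _ => norm_nonneg _) (fun _ => norm_nonneg _)
  have h2 := summable_sum_mul_antidiagonal_of_summable_mul (f := fun n => ‖a n‖) (g := fun n => ‖b n‖) h1
  have h3 : ∀ n : A, ‖∑ kl ∈ antidiagonal n, a kl.1 * b kl.2‖ ≤
      ∑ kl ∈ antidiagonal n, ‖a kl.1‖ * ‖b kl.2‖ := fun n =>
    (norm_sum_le _ _).trans (by simp)
  have h4 := h2.of_nonneg_of_le (fun _ => norm_nonneg _) h3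
  refine ⟨h4, ?_⟩
  have h5 := Summable.tsum_mul_tsum_eq_tsum_sum_antidiagonal (f := fun n => ‖a n‖) (g := fun n => ‖b n‖) ha hb h1
  rw [h5]
  exact h4.tsum_le_tsum h3 h2

lemma mul_aux2 {A : Type*} [AddCommMonoid A] [Finset.HasAntidiagonal A]
    (a b m : A → ℂ) (hm : ∀ p q, m (p + q) = m p * m q)
    (ha : Summable fun n => ‖a n * m n‖) (hb : Summable fun n => ‖b n * m n‖) :
    ∑' n : A, (∑ kl ∈ antidiagonal n, a kl.1 * b kl.2) * m n =
      (∑' n, a n * m n) * ∑' n, b n * m n := by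
  have h5 := Summable.tsum_mul_tsum_eq_tsum_sum_antidiagonal (f := fun n => a n * m n)
    (g := fun n => b n * m n) ha.of_norm hb.of_norm (summable_mul_of_summable_norm (f := fun n => a n * m n)
    (g := fun n => b n * m n) ha hb)
  rw [h5]
  congr 1
  ext n
  rw [Finset.sum_mul]
  refine Finset.sum_congr rfl (fun p hp => ?_)
  rw [mem_antidiagonal] at hp
  rw [← hp, hm]
  ring

noncomputable instance : Mul WA where
  mul a b := mk (fun n => ∑ kl ∈ antidiagonal n, co a kl.1 * co b kl.2)
    (mul_aux _ _ (summable_co a) (summable_co b)).1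

lemma co_mul (a b : WA) (n : Idx) :
    co (a * b) n = ∑ kl ∈ antidiagonal n, co a kl.1 * co b kl.2 := rfl

/-- monomials -/
noncomputable def mon (k : Idx) : WA := mk (fun n => if n = k then 1 else 0) (by
  apply summable_of_ne_finset_zero (s := {k})
  intro b hb
  simp at hb
  simp [hb])

lemma co_mon (k n : Idx) : co (mon k) n = if n = k then 1 else 0 := rfl

lemma norm_mon (k : Idx) : ‖mon k‖ = 1 := by
  rw [norm_WA, tsum_eq_single k]
  · simp [co_mon]
  · intro b hb; simp [co_mon, hb]

noncomputable instance : One WA := ⟨mon 0⟩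

lemma co_one (n : Idx) : co (1 : WA) n = if n = 0 then 1 else 0 := rfl

/-- underlying formal power series -/
def ps (a : WA) : MvPowerSeries (Fin 2) ℂ := fun n => co a n

lemma ps_inj {a b : WA} (h : ps a = ps b) : a = b := co_ext (fun n => congrFun h n)
lemma ps_add (a b : WA) : ps (a + b) = ps a + ps b := rfl
lemma ps_zero : ps 0 = 0 := rfl
lemma ps_mul (a b : WA) : ps (a * b) = ps a * ps b := by
  classical
  ext n
  rw [MvPowerSeries.coeff_mul]
  rfl
lemma ps_one : ps 1 = 1 := by
  classical
  ext n
  rw [MvPowerSeries.coeff_one]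
  rfl

noncomputable instance instCommRingWA : CommRing WA :=
  { (inferInstance : NormedAddCommGroup WA) with
    mul := (· * ·)
    one := 1
    left_distrib := fun a b c => ps_inj (by simp only [ps_mul, ps_add, mul_add])
    right_distrib := fun a b c => ps_inj (by simp only [ps_mul, ps_add, add_mul])
    zero_mul := fun a => ps_inj (by simp only [ps_mul, ps_zero, zero_mul])
    mul_zero := fun a => ps_inj (by simp only [ps_mul, ps_zero, mul_zero])
    mul_assoc := fun a b c => ps_inj (by simp only [ps_mul, mul_assoc])
    one_mul := fun a => ps_inj (by simp only [ps_mul, ps_one, one_mul])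
    mul_one := fun a => ps_inj (by simp only [ps_mul, ps_one, mul_one])
    mul_comm := fun a b => ps_inj (by simp only [ps_mul, mul_comm]) }

noncomputable instance : NormedCommRing WA :=
  { (inferInstance : NormedAddCommGroup WA), instCommRingWA with
    norm_mul_le := fun a b => by
      rw [norm_WA, norm_WA, norm_WA]
      exact (mul_aux _ _ (summable_co a) (summable_co b)).2 }

instance : NormOneClass WA := ⟨norm_mon 0⟩

example (a b : WA) : ‖a * b‖ ≤ ‖a‖ * ‖b‖ := norm_mul_le a b
example (c : ℂ) (a b : WA) : c • (a + b) = c • a + c • b := smul_add c a b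

/-- degree -/
def deg (n : Idx) : ℕ := n 0 + n 1

/-- vanishing below a given order -/
def Ord (k : ℕ) (a : WA) : Prop := ∀ n, deg n < k → co a n = 0

lemma Ord.mul {j k : ℕ} {a b : WA} (ha : Ord j a) (hb : Ord k b) : Ord (j + k) (a * b) := by
  intro n hn
  rw [co_mul]
  apply Finset.sum_eq_zero
  rintro ⟨p, q⟩ hpq
  rw [mem_antidiagonal] at hpq
  simp only at hpq ⊢
  subst hpq
  simp only [deg, Finsupp.add_apply] at hn
  by_cases h : deg p < j
  · rw [ha p h, zero_mul]
  · have : deg q < k := by simp only [deg] at h ⊢; omega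
    rw [hb q this, mul_zero]

lemma Ord.pow {a : WA} (ha : Ord 1 a) (k : ℕ) : Ord k (a ^ k) := by
  induction k with
  | zero => intro n hn; omega
  | succ k ih => rw [pow_succ]; exact ih.mul ha

/-- monomial functions -/
def m (n : Idx) (x : ℂ × ℂ) : ℂ := x.1 ^ n 0 * x.2 ^ n 1

lemma m_add (n k : Idx) (x : ℂ × ℂ) : m (n + k) x = m n x * m k x := by
  simp only [m, Finsupp.add_apply]; ring

lemma norm_m_le (n : Idx) {x : ℂ × ℂ} (hx : ‖x‖ ≤ 1) : ‖m n x‖ ≤ 1 := by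
  have h1 : ‖x.1‖ ≤ 1 := (norm_fst_le x).trans hx
  have h2 : ‖x.2‖ ≤ 1 := (norm_snd_le x).trans hx
  simp only [m, norm_mul, norm_pow]
  exact mul_le_one₀ (pow_le_one₀ (norm_nonneg _) h1) (by positivity) (pow_le_one₀ (norm_nonneg _) h2)

section op
variable {E : Type*} [NormedAddCommGroup E] [NormedSpace ℂ E]

lemma op_summable (v : Idx → E) (C : ℝ) (hv : ∀ n, ‖v n‖ ≤ C) (a : WA) :
    Summable (fun n => ‖co a n • v n‖) := by
  refine ((summable_co a).mul_right C).of_nonneg_of_le (fun _ => norm_nonneg _) (fun n => ?_)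
  rw [norm_smul]
  exact mul_le_mul_of_nonneg_left (hv n) (norm_nonneg _)

variable [CompleteSpace E]

/-- the bounded operator sending the monomial `n` to `v n`. -/
noncomputable def op (v : Idx → E) (C : ℝ) (hv : ∀ n, ‖v n‖ ≤ C) : WA →L[ℂ] E :=
  LinearMap.mkContinuous
    { toFun := fun a => ∑' n, co a n • v n
      map_add' := fun a b => by
        rw [← (op_summable v C hv a).of_norm.tsum_add (op_summable v C hv b).of_norm]
        simp only [co_add, add_smul]
      map_smul' := fun c a => by
        simp only [co_smul, mul_smul, RingHom.id_apply]
        exact (op_summable v C hv a).of_norm.tsum_const_smul c } C (fun a => by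
    simp only [LinearMap.coe_mk, AddHom.coe_mk]
    refine (norm_tsum_le_tsum_norm (op_summable v C hv a)).trans ?_
    rw [norm_WA, ← tsum_mul_left]
    refine (op_summable v C hv a).tsum_le_tsum (fun n => ?_) ((summable_co a).mul_left C)
    rw [norm_smul, mul_comm]
    exact mul_le_mul_of_nonneg_right (hv n) (norm_nonneg _))

lemma op_apply (v : Idx → E) (C : ℝ) (hv : ∀ n, ‖v n‖ ≤ C) (a : WA) :
    op v C hv a = ∑' n, co a n • v n := rfl

lemma op_norm_le (v : Idx → E) (C : ℝ) (hv : ∀ n, ‖v n‖ ≤ C) (hC : 0 ≤ C) (a : WA) :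
    ‖op v C hv a‖ ≤ C * ‖a‖ :=
  ((op v C hv).le_opNorm a).trans
    (mul_le_mul_of_nonneg_right (LinearMap.mkContinuous_norm_le _ hC _) (norm_nonneg _))

end op

/-- evaluation at a point of the closed unit polydisc -/
noncomputable def ev (x : ℂ × ℂ) (hx : ‖x‖ ≤ 1) : WA →L[ℂ] ℂ :=
  op (fun n => m n x) 1 (fun n => norm_m_le n hx)

lemma ev_apply (x : ℂ × ℂ) (hx : ‖x‖ ≤ 1) (a : WA) : ev x hx a = ∑' n, co a n * m n x := rfl

lemma ev_norm_le (x : ℂ × ℂ) (hx : ‖x‖ ≤ 1) (a : WA) : ‖ev x hx a‖ ≤ ‖a‖ := by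
  have := op_norm_le (fun n => m n x) 1 (fun n => norm_m_le n hx) zero_le_one a
  rw [one_mul] at this
  exact this

lemma ev_mon (x : ℂ × ℂ) (hx : ‖x‖ ≤ 1) (k : Idx) : ev x hx (mon k) = m k x := by
  rw [ev_apply, tsum_eq_single k]
  · simp [co_mon]
  · intro b hb; simp [co_mon, hb]

lemma ev_one (x : ℂ × ℂ) (hx : ‖x‖ ≤ 1) : ev x hx 1 = 1 := by
  have := ev_mon x hx 0
  rw [show m 0 x = 1 by simp [m]] at this
  exact this

lemma ev_summable (x : ℂ × ℂ) (hx : ‖x‖ ≤ 1) (a : WA) : Summable (fun n => ‖co a n * m n x‖) :=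
  op_summable (fun n => m n x) 1 (fun n => norm_m_le n hx) a

lemma ev_mul (x : ℂ × ℂ) (hx : ‖x‖ ≤ 1) (a b : WA) : ev x hx (a * b) = ev x hx a * ev x hx b := by
  rw [ev_apply, ev_apply, ev_apply]
  exact mul_aux2 (co a) (co b) (fun n => m n x) (fun p q => m_add p q x)
    (ev_summable x hx a) (ev_summable x hx b)

lemma ev_pow (x : ℂ × ℂ) (hx : ‖x‖ ≤ 1) (a : WA) (k : ℕ) : ev x hx (a ^ k) = ev x hx a ^ k := by
  induction k with
  | zero => simp [ev_one]
  | succ k ih => rw [pow_succ, pow_succ, ev_mul, ih]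

/-- coefficient functional -/
noncomputable def coL (k : Idx) : WA →L[ℂ] ℂ :=
  LinearMap.mkContinuous
    { toFun := fun a => co a k
      map_add' := fun _ _ => rfl
      map_smul' := fun _ _ => rfl } 1 (fun a => by rw [one_mul]; exact norm_co_le a k)

lemma coL_apply (k : Idx) (a : WA) : coL k a = co a k := rfl

end PL

namespace PL

/-- weight of a coefficient -/
noncomputable def wt (p : ℕ × ℕ) : ℝ := ((p.1 : ℝ) + p.2) * 2 ^ (p.1 + p.2)

lemma wt_nonneg (p) : 0 ≤ wt p := by unfold wt; positivity

/-- substitution of two elements into a power series -/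
noncomputable def Fs (c : ℕ × ℕ → ℂ) (X Y : WA) : WA := ∑' p : ℕ × ℕ, c p • (X ^ p.1 * Y ^ p.2)

lemma norm_pow_le2 {X : WA} (hX : ‖X‖ ≤ 2) (a : ℕ) : ‖X ^ a‖ ≤ 2 ^ a :=
  (norm_pow_le X a).trans (pow_le_pow_left₀ (norm_nonneg _) hX a)

lemma pow_diff {X X' : WA} (hX : ‖X‖ ≤ 2) (hX' : ‖X'‖ ≤ 2) {t : ℝ} (ht : ‖X - X'‖ ≤ t) (a : ℕ) :
    ‖X ^ a - X' ^ a‖ ≤ a * 2 ^ a * t := by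
  have ht0 : 0 ≤ t := (norm_nonneg _).trans ht
  induction a with
  | zero => simp
  | succ a ih =>
    have e : X ^ (a + 1) - X' ^ (a + 1) = X ^ a * (X - X') + (X ^ a - X' ^ a) * X' := by ring
    rw [e]
    refine (norm_add_le _ _).trans ?_
    have h1 : ‖X ^ a * (X - X')‖ ≤ 2 ^ a * t :=
      (norm_mul_le _ _).trans (mul_le_mul (norm_pow_le2 hX a) ht (norm_nonneg _) (by positivity))
    have h2 : ‖(X ^ a - X' ^ a) * X'‖ ≤ (a * 2 ^ a * t) * 2 :=
      (norm_mul_le _ _).trans (mul_le_mul ih hX' (norm_nonneg _) (by positivity))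
    have h3 : 0 ≤ (2 : ℝ) ^ a * t := by positivity
    push_cast
    rw [pow_succ]
    nlinarith

lemma mon_diff {X X' Y Y' : WA} (hX : ‖X‖ ≤ 2) (hX' : ‖X'‖ ≤ 2) (hY : ‖Y‖ ≤ 2) (hY' : ‖Y'‖ ≤ 2)
    {t : ℝ} (ht : ‖X - X'‖ ≤ t) (ht' : ‖Y - Y'‖ ≤ t) (p : ℕ × ℕ) :
    ‖X ^ p.1 * Y ^ p.2 - X' ^ p.1 * Y' ^ p.2‖ ≤ wt p * t := by
  have ht0 : 0 ≤ t := (norm_nonneg _).trans ht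
  obtain ⟨a, b⟩ := p
  simp only [wt]
  have e : X ^ a * Y ^ b - X' ^ a * Y' ^ b = X ^ a * (Y ^ b - Y' ^ b) + (X ^ a - X' ^ a) * Y' ^ b := by
    ring
  rw [e]
  refine (norm_add_le _ _).trans ?_
  have h1 : ‖X ^ a * (Y ^ b - Y' ^ b)‖ ≤ 2 ^ a * (b * 2 ^ b * t) :=
    (norm_mul_le _ _).trans (mul_le_mul (norm_pow_le2 hX a) (pow_diff hY hY' ht' b)
      (norm_nonneg _) (by positivity))
  have h2 : ‖(X ^ a - X' ^ a) * Y' ^ b‖ ≤ (a * 2 ^ a * t) * 2 ^ b :=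
    (norm_mul_le _ _).trans (mul_le_mul (pow_diff hX hX' ht a) (norm_pow_le2 hY' b)
      (norm_nonneg _) (by positivity))
  rw [pow_add]
  linarith

section
variable {c : ℕ × ℕ → ℂ} {κ : ℝ} (hc0 : ∀ p : ℕ × ℕ, p.1 + p.2 < 2 → c p = 0)
  (hc : HasSum (fun p => ‖c p‖ * wt p) κ)
include hc0

lemma Fs_term {X Y : WA} (hX : ‖X‖ ≤ 2) (hY : ‖Y‖ ≤ 2) (p : ℕ × ℕ) :
    ‖c p • (X ^ p.1 * Y ^ p.2)‖ ≤ ‖c p‖ * wt p := by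
  by_cases h : p.1 + p.2 < 2
  · simp [hc0 p h]
  · rw [norm_smul]
    refine mul_le_mul_of_nonneg_left ?_ (norm_nonneg _)
    have h1 : ‖X ^ p.1 * Y ^ p.2‖ ≤ 2 ^ p.1 * 2 ^ p.2 :=
      (norm_mul_le _ _).trans (mul_le_mul (norm_pow_le2 hX _) (norm_pow_le2 hY _)
        (norm_nonneg _) (by positivity))
    refine h1.trans ?_
    rw [wt, ← pow_add]
    have h2 : (1 : ℝ) ≤ (p.1 : ℝ) + p.2 := by
      have : 1 ≤ p.1 + p.2 := by omega
      exact_mod_cast this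
    exact le_mul_of_one_le_left (by positivity) h2

include hc

lemma Fs_summable {X Y : WA} (hX : ‖X‖ ≤ 2) (hY : ‖Y‖ ≤ 2) :
    Summable (fun p : ℕ × ℕ => c p • (X ^ p.1 * Y ^ p.2)) :=
  Summable.of_norm_bounded hc.summable (Fs_term hc0 hX hY)

lemma Fs_norm {X Y : WA} (hX : ‖X‖ ≤ 2) (hY : ‖Y‖ ≤ 2) : ‖Fs c X Y‖ ≤ κ :=
  tsum_of_norm_bounded hc (Fs_term hc0 hX hY)

lemma Fs_lip {X X' Y Y' : WA} (hX : ‖X‖ ≤ 2) (hX' : ‖X'‖ ≤ 2) (hY : ‖Y‖ ≤ 2) (hY' : ‖Y'‖ ≤ 2)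
    {t : ℝ} (ht : ‖X - X'‖ ≤ t) (ht' : ‖Y - Y'‖ ≤ t) : ‖Fs c X Y - Fs c X' Y'‖ ≤ κ * t := by
  rw [Fs, Fs, ← (Fs_summable hc0 hc hX hY).tsum_sub (Fs_summable hc0 hc hX' hY')]
  refine tsum_of_norm_bounded (hc.mul_right t) (fun p => ?_)
  rw [← smul_sub, norm_smul, mul_assoc]
  exact mul_le_mul_of_nonneg_left (mon_diff hX hX' hY hY' ht ht' p) (norm_nonneg _)

lemma Fs_ev {X Y : WA} (hX : ‖X‖ ≤ 2) (hY : ‖Y‖ ≤ 2) (x : ℂ × ℂ) (hx : ‖x‖ ≤ 1) :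
    ev x hx (Fs c X Y) = ∑' p : ℕ × ℕ, c p * ((ev x hx X) ^ p.1 * (ev x hx Y) ^ p.2) := by
  rw [Fs, (ev x hx).map_tsum (Fs_summable hc0 hc hX hY)]
  simp only [map_smul, ev_mul, ev_pow, smul_eq_mul]

lemma Fs_ord {X Y : WA} (hX : ‖X‖ ≤ 2) (hY : ‖Y‖ ≤ 2) (hX1 : Ord 1 X) (hY1 : Ord 1 Y) :
    Ord 2 (Fs c X Y) := by
  intro n hn
  rw [← coL_apply, Fs, (coL n).map_tsum (Fs_summable hc0 hc hX hY)]
  convert tsum_zero with p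
  rw [map_smul, coL_apply]
  by_cases h : p.1 + p.2 < 2
  · simp [hc0 p h]
  · rw [((hX1.pow p.1).mul (hY1.pow p.2)) n (by omega), smul_zero]

end

/-- small divisor -/
noncomputable def dv (l₁ l₂ l : ℂ) (n : Idx) : ℂ := n 0 * l₁ + n 1 * l₂ - l

/-- The first index -/
noncomputable def i0 : Idx := Finsupp.single 0 1
/-- The second index -/
noncomputable def i1 : Idx := Finsupp.single 1 1

/-- values of the inverse of the homological operator -/
noncomputable def vS (l₁ l₂ l : ℂ) (n : Idx) : WA :=
  if 2 ≤ deg n then (dv l₁ l₂ l n)⁻¹ • mon n else 0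

/-- values of the nilpotent part -/
noncomputable def vK (l₁ l₂ l : ℂ) (n : Idx) : WA :=
  if 2 ≤ deg n then ((n 0 : ℂ) / (dv l₁ l₂ l n)) • mon (n - i0 + i1) else 0

/-- divisor bound -/
def Div (l₁ l₂ l : ℂ) (c : ℝ) : Prop := ∀ n : Idx, 2 ≤ deg n → c * deg n ≤ ‖dv l₁ l₂ l n‖

section
variable {l₁ l₂ l : ℂ} {c : ℝ} (hc : 0 < c) (hd : Div l₁ l₂ l c)
include hc hd

lemma dv_ne (n : Idx) (hn : 2 ≤ deg n) : dv l₁ l₂ l n ≠ 0 := by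
  have h1 := hd n hn
  have h2 : (0 : ℝ) < deg n := by exact_mod_cast (by omega : 0 < deg n)
  have : 0 < ‖dv l₁ l₂ l n‖ := lt_of_lt_of_le (by positivity) h1
  exact norm_pos_iff.mp this

lemma inv_le (n : Idx) (hn : 2 ≤ deg n) : (deg n : ℝ) * ‖(dv l₁ l₂ l n)⁻¹‖ ≤ c⁻¹ := by
  have h1 := hd n hn
  have h0 : 0 < ‖dv l₁ l₂ l n‖ := norm_pos_iff.mpr (dv_ne hc hd n hn)
  rw [norm_inv, ← div_eq_mul_inv, div_le_iff₀ h0, ← div_eq_inv_mul, le_div_iff₀ hc]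
  linarith

lemma vS_le (n : Idx) : ‖vS l₁ l₂ l n‖ ≤ c⁻¹ := by
  unfold vS
  split_ifs with h
  · rw [norm_smul, norm_mon, mul_one]
    refine le_trans ?_ (inv_le hc hd n h)
    refine le_mul_of_one_le_left (norm_nonneg _) ?_
    exact_mod_cast (by omega : 1 ≤ deg n)
  · simp [hc.le]

lemma vK_le (n : Idx) : ‖vK l₁ l₂ l n‖ ≤ c⁻¹ := by
  unfold vK
  split_ifs with h
  · rw [norm_smul, norm_mon, mul_one]
    refine le_trans ?_ (inv_le hc hd n h)
    rw [div_eq_mul_inv, norm_mul]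
    refine mul_le_mul_of_nonneg_right ?_ (norm_nonneg _)
    simp only [Complex.norm_natCast]
    exact_mod_cast (by simp [deg] : n 0 ≤ deg n)
  · simp [hc.le]

lemma S_le (a : WA) : ‖op (vS l₁ l₂ l) c⁻¹ (vS_le hc hd) a‖ ≤ c⁻¹ * ‖a‖ :=
  op_norm_le _ _ _ (by positivity) a

lemma K_le (a : WA) : ‖op (vK l₁ l₂ l) c⁻¹ (vK_le hc hd) a‖ ≤ c⁻¹ * ‖a‖ :=
  op_norm_le _ _ _ (by positivity) a

end

lemma op_ord (v : Idx → WA) (C : ℝ) (hv : ∀ n, ‖v n‖ ≤ C) (h : ∀ n, Ord 2 (v n)) (a : WA) :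
    Ord 2 (op v C hv a) := by
  intro k hk
  rw [← coL_apply, op_apply, (coL k).map_tsum (op_summable v C hv a).of_norm]
  convert tsum_zero with n
  rw [map_smul, coL_apply, h n k hk, smul_zero]

lemma ord_mon {k : ℕ} {n : Idx} (h : k ≤ deg n) : Ord k (mon n) := by
  intro j hj
  rw [co_mon, if_neg]
  rintro rfl
  omega

lemma vS_ord (l₁ l₂ l : ℂ) (n : Idx) : Ord 2 (vS l₁ l₂ l n) := by
  intro k hk
  unfold vS
  split_ifs with h
  · rw [co_smul, ord_mon h k hk, mul_zero]
  · rfl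

lemma deg_shift (n : Idx) (h : n 0 ≠ 0) : deg (n - i0 + i1) = deg n := by
  simp only [deg, i0, i1, Finsupp.add_apply, Finsupp.tsub_apply, Finsupp.single_apply]
  simp
  omega

lemma vK_ord (l₁ l₂ l : ℂ) (n : Idx) : Ord 2 (vK l₁ l₂ l n) := by
  intro k hk
  unfold vK
  split_ifs with h
  · by_cases h0 : n 0 = 0
    · rw [co_smul]; simp [h0]
    · rw [co_smul, ord_mon (by rw [deg_shift n h0]; exact h) k hk, mul_zero]
  · rfl

/-- The fixed point. -/
theorem exists_fixed {l₁ l₂ ε : ℂ} {c : ℝ} (hc : 0 < c) (hd1 : Div l₁ l₂ l₁ c) (hd2 : Div l₁ l₂ l₂ c)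
    (hε : ‖ε‖ ≤ c / 8) {a b : ℕ × ℕ → ℂ} {κ₁ κ₂ : ℝ}
    (ha0 : ∀ p : ℕ × ℕ, p.1 + p.2 < 2 → a p = 0) (hb0 : ∀ p : ℕ × ℕ, p.1 + p.2 < 2 → b p = 0)
    (ha : HasSum (fun p => ‖a p‖ * wt p) κ₁) (hb : HasSum (fun p => ‖b p‖ * wt p) κ₂)
    (hκ₁ : κ₁ ≤ c / 4) (hκ₂ : κ₂ ≤ c / 4) :
    ∃ g₁ g₂ h₁ h₂ : WA, 
      h₁ = op (vS l₁ l₂ l₁) c⁻¹ (vS_le hc hd1) g₁ ∧ 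
      h₂ = op (vS l₁ l₂ l₂) c⁻¹ (vS_le hc hd2) g₂ ∧
      ‖h₁‖ ≤ 1 ∧ ‖h₂‖ ≤ 1 ∧ Ord 2 g₁ ∧ Ord 2 g₂ ∧
      g₁ = Fs a (mon i0 + h₁) (mon i1 + h₂) -
        ε • (op (vK l₁ l₂ l₁) c⁻¹ (vK_le hc hd1) g₁ - h₂) ∧
      g₂ = Fs b (mon i0 + h₁) (mon i1 + h₂) - ε • (op (vK l₁ l₂ l₂) c⁻¹ (vK_le hc hd2) g₂) := by
  set S₁ := op (vS l₁ l₂ l₁) c⁻¹ (vS_le hc hd1) with hS₁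
  set S₂ := op (vS l₁ l₂ l₂) c⁻¹ (vS_le hc hd2) with hS₂
  set K₁ := op (vK l₁ l₂ l₁) c⁻¹ (vK_le hc hd1) with hK₁
  set K₂ := op (vK l₁ l₂ l₂) c⁻¹ (vK_le hc hd2) with hK₂
  have bS₁ : ∀ g, ‖S₁ g‖ ≤ c⁻¹ * ‖g‖ := S_le hc hd1
  have bS₂ : ∀ g, ‖S₂ g‖ ≤ c⁻¹ * ‖g‖ := S_le hc hd2
  have bK₁ : ∀ g, ‖K₁ g‖ ≤ c⁻¹ * ‖g‖ := K_le hc hd1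
  have bK₂ : ∀ g, ‖K₂ g‖ ≤ c⁻¹ * ‖g‖ := K_le hc hd2
  have hcc : c⁻¹ * c = 1 := inv_mul_cancel₀ hc.ne'
  have hci : 0 < c⁻¹ := by positivity
  -- bound for small h
  have small : ∀ (k : Idx) (h : WA), ‖h‖ ≤ 1 → ‖mon k + h‖ ≤ 2 := fun k h hh =>
    (norm_add_le _ _).trans (by rw [norm_mon]; linarith)
  let Θ : WA × WA → WA × WA := fun g =>
    (Fs a (mon i0 + S₁ g.1) (mon i1 + S₂ g.2) - ε • (K₁ g.1 - S₂ g.2),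
     Fs b (mon i0 + S₁ g.1) (mon i1 + S₂ g.2) - ε • (K₂ g.2))
  let B : Set (WA × WA) := Metric.closedBall 0 c
  have hB1 : ∀ g ∈ B, ‖S₁ g.1‖ ≤ 1 := fun g hg => by
    have h1 : ‖g.1‖ ≤ c := (norm_fst_le g).trans (by simpa [B] using hg)
    refine (bS₁ _).trans ?_
    calc c⁻¹ * ‖g.1‖ ≤ c⁻¹ * c := by gcongr
      _ = 1 := hcc
  have hB2 : ∀ g ∈ B, ‖S₂ g.2‖ ≤ 1 := fun g hg => by
    have h1 : ‖g.2‖ ≤ c := (norm_snd_le g).trans (by simpa [B] using hg)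
    refine (bS₂ _).trans ?_
    calc c⁻¹ * ‖g.2‖ ≤ c⁻¹ * c := by gcongr
      _ = 1 := hcc
  have lip : ∀ g ∈ B, ∀ g' ∈ B, ‖Θ g - Θ g'‖ ≤ 1 / 2 * ‖g - g'‖ := by
    intro g hg g' hg'
    set t := ‖g - g'‖ with ht
    have ht0 : 0 ≤ t := norm_nonneg _
    have t1 : ‖g.1 - g'.1‖ ≤ t := norm_fst_le (g - g')
    have t2 : ‖g.2 - g'.2‖ ≤ t := norm_snd_le (g - g')
    have s1 : ‖S₁ g.1 - S₁ g'.1‖ ≤ c⁻¹ * t := by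
      rw [← map_sub]; exact (bS₁ _).trans (by gcongr)
    have s2 : ‖S₂ g.2 - S₂ g'.2‖ ≤ c⁻¹ * t := by
      rw [← map_sub]; exact (bS₂ _).trans (by gcongr)
    have k1 : ‖K₁ g.1 - K₁ g'.1‖ ≤ c⁻¹ * t := by
      rw [← map_sub]; exact (bK₁ _).trans (by gcongr)
    have k2 : ‖K₂ g.2 - K₂ g'.2‖ ≤ c⁻¹ * t := by
      rw [← map_sub]; exact (bK₂ _).trans (by gcongr)
    have f1 := Fs_lip ha0 ha (small i0 _ (hB1 g hg)) (small i0 _ (hB1 g' hg'))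
      (small i1 _ (hB2 g hg)) (small i1 _ (hB2 g' hg')) (t := c⁻¹ * t)
      (by rw [add_sub_add_left_eq_sub]; exact s1) (by rw [add_sub_add_left_eq_sub]; exact s2)
    have f2 := Fs_lip hb0 hb (small i0 _ (hB1 g hg)) (small i0 _ (hB1 g' hg'))
      (small i1 _ (hB2 g hg)) (small i1 _ (hB2 g' hg')) (t := c⁻¹ * t)
      (by rw [add_sub_add_left_eq_sub]; exact s1) (by rw [add_sub_add_left_eq_sub]; exact s2)
    have hct : 0 ≤ c⁻¹ * t := by positivity
    have q1 : κ₁ * (c⁻¹ * t) ≤ 1 / 4 * t := by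
      calc κ₁ * (c⁻¹ * t) ≤ c / 4 * (c⁻¹ * t) := by gcongr
        _ = 1 / 4 * (c⁻¹ * c) * t := by ring
        _ = 1 / 4 * t := by rw [hcc]; ring
    have q2 : κ₂ * (c⁻¹ * t) ≤ 1 / 4 * t := by
      calc κ₂ * (c⁻¹ * t) ≤ c / 4 * (c⁻¹ * t) := by gcongr
        _ = 1 / 4 * (c⁻¹ * c) * t := by ring
        _ = 1 / 4 * t := by rw [hcc]; ring
    have q3 : ‖ε‖ * (c⁻¹ * t) ≤ 1 / 8 * t := by
      calc ‖ε‖ * (c⁻¹ * t) ≤ c / 8 * (c⁻¹ * t) := by gcongr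
        _ = 1 / 8 * (c⁻¹ * c) * t := by ring
        _ = 1 / 8 * t := by rw [hcc]; ring
    refine norm_prod_le_iff.mpr ⟨?_, ?_⟩
    · have e : (Θ g - Θ g').1 = (Fs a (mon i0 + S₁ g.1) (mon i1 + S₂ g.2) -
          Fs a (mon i0 + S₁ g'.1) (mon i1 + S₂ g'.2)) -
          ε • (K₁ g.1 - K₁ g'.1) + ε • (S₂ g.2 - S₂ g'.2) := by
        simp only [Θ, Prod.fst_sub, smul_sub]; abel
      rw [e]
      refine (norm_add_le _ _).trans ?_
      refine (add_le_add_left (norm_sub_le _ _) _).trans ?_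
      rw [norm_smul, norm_smul]
      have u1 : ‖ε‖ * ‖K₁ g.1 - K₁ g'.1‖ ≤ ‖ε‖ * (c⁻¹ * t) := by gcongr
      have u2 : ‖ε‖ * ‖S₂ g.2 - S₂ g'.2‖ ≤ ‖ε‖ * (c⁻¹ * t) := by gcongr
      linarith
    · have e : (Θ g - Θ g').2 = (Fs b (mon i0 + S₁ g.1) (mon i1 + S₂ g.2) -
          Fs b (mon i0 + S₁ g'.1) (mon i1 + S₂ g'.2)) -
          ε • (K₂ g.2 - K₂ g'.2) := by
        simp only [Θ, Prod.snd_sub, smul_sub]; abel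
      rw [e]
      refine (norm_sub_le _ _).trans ?_
      rw [norm_smul]
      have u1 : ‖ε‖ * ‖K₂ g.2 - K₂ g'.2‖ ≤ ‖ε‖ * (c⁻¹ * t) := by gcongr
      linarith
  have h0B : (0 : WA × WA) ∈ B := by simp [B, hc.le]
  have hΘ0 : ‖Θ 0‖ ≤ c / 4 := by
    refine norm_prod_le_iff.mpr ⟨?_, ?_⟩
    · have := Fs_norm ha0 ha (small i0 _ (hB1 0 h0B)) (small i1 _ (hB2 0 h0B))
      simp only [Θ, Prod.fst_zero, Prod.snd_zero, map_zero, sub_zero, smul_zero] at this ⊢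
      exact this.trans hκ₁
    · have := Fs_norm hb0 hb (small i0 _ (hB1 0 h0B)) (small i1 _ (hB2 0 h0B))
      simp only [Θ, Prod.fst_zero, Prod.snd_zero, map_zero, sub_zero, smul_zero] at this ⊢
      exact this.trans hκ₂
  have maps : Set.MapsTo Θ B B := by
    intro g hg
    have h1 := lip g hg 0 h0B
    have h2 : ‖g‖ ≤ c := by simpa [B] using hg
    have h3 : ‖Θ g‖ ≤ ‖Θ g - Θ 0‖ + ‖Θ 0‖ := by
      simpa using norm_add_le (Θ g - Θ 0) (Θ 0)
    rw [sub_zero] at h1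
    simp only [B, mem_closedBall_zero_iff]
    linarith
  have hcontr : ContractingWith (1 / 2) (maps.restrict Θ B B) := by
    refine ⟨by
      rw [← NNReal.coe_lt_coe]; norm_num, LipschitzWith.of_dist_le_mul (fun x y => ?_)⟩
    have := lip x.1 x.2 y.1 y.2
    rw [Subtype.dist_eq, Subtype.dist_eq, dist_eq_norm, dist_eq_norm]
    simpa using this
  obtain ⟨g, hgB, hfix, -⟩ := hcontr.exists_fixedPoint' Metric.isClosed_closedBall.isComplete
    maps h0B (edist_ne_top _ _)
  have e1 : g.1 = Fs a (mon i0 + S₁ g.1) (mon i1 + S₂ g.2) - ε • (K₁ g.1 - S₂ g.2) :=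
    (congrArg Prod.fst hfix).symm
  have e2 : g.2 = Fs b (mon i0 + S₁ g.1) (mon i1 + S₂ g.2) - ε • (K₂ g.2) :=
    (congrArg Prod.snd hfix).symm
  have oS₁ : Ord 2 (S₁ g.1) := op_ord _ _ _ (vS_ord _ _ _) _
  have oS₂ : Ord 2 (S₂ g.2) := op_ord _ _ _ (vS_ord _ _ _) _
  have oK₁ : Ord 2 (K₁ g.1) := op_ord _ _ _ (vK_ord _ _ _) _
  have oK₂ : Ord 2 (K₂ g.2) := op_ord _ _ _ (vK_ord _ _ _) _
  have oX : Ord 1 (mon i0 + S₁ g.1) := fun n hn => by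
    rw [co_add, oS₁ n (by omega), ord_mon (k := 1) (by simp [deg, i0]) n hn, add_zero]
  have oY : Ord 1 (mon i1 + S₂ g.2) := fun n hn => by
    rw [co_add, oS₂ n (by omega), ord_mon (k := 1) (by simp [deg, i1]) n hn, add_zero]
  have nX := small i0 _ (hB1 g hgB)
  have nY := small i1 _ (hB2 g hgB)
  refine ⟨g.1, g.2, S₁ g.1, S₂ g.2, rfl, rfl, hB1 g hgB, hB2 g hgB, ?_, ?_, e1, e2⟩
  · intro n hn
    rw [e1, co_sub, co_smul, co_sub, Fs_ord ha0 ha nX nY oX oY n hn, oK₁ n hn, oS₂ n hn]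
    simp
  · intro n hn
    rw [e2, co_sub, co_smul, Fs_ord hb0 hb nX nY oX oY n hn, oK₂ n hn]
    simp

end PL

namespace PL

section series
variable {ι : Type*}

/-- derivative of a monomial -/
noncomputable def mD (p q : ℕ) (x : ℂ × ℂ) : ℂ × ℂ →L[ℂ] ℂ :=
  ((p : ℂ) * x.1 ^ (p - 1) * x.2 ^ q) • ContinuousLinearMap.fst ℂ ℂ ℂ +
  ((q : ℂ) * x.1 ^ p * x.2 ^ (q - 1)) • ContinuousLinearMap.snd ℂ ℂ ℂ

lemma mD_apply (p q : ℕ) (x v : ℂ × ℂ) : mD p q x v =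
    ((p : ℂ) * x.1 ^ (p - 1) * x.2 ^ q) * v.1 + ((q : ℂ) * x.1 ^ p * x.2 ^ (q - 1)) * v.2 := by
  simp [mD]

lemma mD_hasFDerivAt (p q : ℕ) (x : ℂ × ℂ) :
    HasFDerivAt (fun x : ℂ × ℂ => x.1 ^ p * x.2 ^ q) (mD p q x) x := by
  have h1 : HasFDerivAt (fun x : ℂ × ℂ => x.1) (ContinuousLinearMap.fst ℂ ℂ ℂ) x := hasFDerivAt_fst
  have h2 : HasFDerivAt (fun x : ℂ × ℂ => x.2) (ContinuousLinearMap.snd ℂ ℂ ℂ) x := hasFDerivAt_snd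
  refine ((h1.pow p).mul (h2.pow q)).congr_fderiv ?_
  refine ContinuousLinearMap.ext (fun v => ?_)
  rw [mD_apply]
  simp
  ring

lemma mD_norm (p q : ℕ) {x : ℂ × ℂ} (hx : ‖x‖ ≤ 1) : ‖mD p q x‖ ≤ (p : ℝ) + q := by
  have h1 : ‖x.1‖ ≤ 1 := (norm_fst_le x).trans hx
  have h2 : ‖x.2‖ ≤ 1 := (norm_snd_le x).trans hx
  have k : ∀ i j : ℕ, ‖x.1‖ ^ i * ‖x.2‖ ^ j ≤ 1 := fun i j =>
    mul_le_one₀ (pow_le_one₀ (norm_nonneg _) h1) (by positivity) (pow_le_one₀ (norm_nonneg _) h2)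
  refine ContinuousLinearMap.opNorm_le_bound _ (by positivity) (fun v => ?_)
  rw [mD_apply]
  refine (norm_add_le _ _).trans ?_
  simp only [norm_mul, norm_pow, Complex.norm_natCast]
  have v1 := norm_fst_le v
  have v2 := norm_snd_le v
  rw [add_mul]
  refine add_le_add ?_ ?_
  · rw [mul_assoc (p : ℝ), mul_assoc (p : ℝ)]
    refine mul_le_mul_of_nonneg_left ?_ (by positivity)
    exact (mul_le_mul (k _ _) v1 (norm_nonneg _) zero_le_one).trans (by simp)
  · rw [mul_assoc (q : ℝ), mul_assoc (q : ℝ)]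
    refine mul_le_mul_of_nonneg_left ?_ (by positivity)
    exact (mul_le_mul (k _ _) v2 (norm_nonneg _) zero_le_one).trans (by simp)

lemma mD_cont (p q : ℕ) : Continuous (mD p q) := by
  unfold mD
  fun_prop

variable (P Q : ι → ℕ) (b : ι → ℂ) (hb : Summable (fun i => ‖b i‖))
  (hb' : Summable (fun i => ‖b i‖ * ((P i : ℝ) + Q i)))
include hb'

lemma mD_summable {x : ℂ × ℂ} (hx : ‖x‖ ≤ 1) : Summable (fun i => b i • mD (P i) (Q i) x) :=
  Summable.of_norm_bounded hb' (fun i => by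
    rw [norm_smul]
    exact mul_le_mul_of_nonneg_left (mD_norm _ _ hx) (norm_nonneg _))

include hb

lemma series_hasFDerivAt {x : ℂ × ℂ} (hx : ‖x‖ < 1) :
    HasFDerivAt (fun x : ℂ × ℂ => ∑' i, b i * (x.1 ^ P i * x.2 ^ Q i))
      (∑' i, b i • mD (P i) (Q i) x) x := by
  have hs : IsPreconnected (Metric.ball (0 : ℂ × ℂ) 1) := (convex_ball 0 1).isPreconnected
  refine hasFDerivAt_tsum_of_isPreconnected hb' Metric.isOpen_ball hs
    (f := fun i x => b i * (x.1 ^ P i * x.2 ^ Q i)) (f' := fun i x => b i • mD (P i) (Q i) x)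
    (x₀ := 0) (fun i y _ => (mD_hasFDerivAt _ _ y).const_mul (b i)) (fun i y hy => ?_) (by simp) ?_
    (by simpa using hx)
  · rw [norm_smul]
    refine mul_le_mul_of_nonneg_left (mD_norm _ _ ?_) (norm_nonneg _)
    simpa using (mem_ball_zero_iff.mp hy).le
  · refine Summable.of_norm_bounded hb (fun i => ?_)
    rw [norm_mul]
    refine mul_le_of_le_one_right (norm_nonneg _) ?_
    rw [norm_mul, norm_pow, norm_pow]
    exact mul_le_one₀ (pow_le_one₀ (norm_nonneg _) (by simp)) (by positivity)
      (pow_le_one₀ (norm_nonneg _) (by simp))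

lemma series_contDiffOn :
    ContDiffOn ℂ 1 (fun x : ℂ × ℂ => ∑' i, b i * (x.1 ^ P i * x.2 ^ Q i)) (Metric.ball 0 1) := by
  rw [show (1 : WithTop ℕ∞) = 0 + 1 from rfl, contDiffOn_succ_iff_fderiv_of_isOpen Metric.isOpen_ball]
  refine ⟨fun x hx => (series_hasFDerivAt P Q b hb hb'
    (mem_ball_zero_iff.mp hx)).differentiableAt.differentiableWithinAt, by simp, ?_⟩
  rw [contDiffOn_zero]
  have : ContinuousOn (fun x => ∑' i, b i • mD (P i) (Q i) x) (Metric.ball 0 1) := by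
    refine continuousOn_tsum (fun i => ((mD_cont (P i) (Q i)).const_smul (b i)).continuousOn) hb' (fun i y hy => ?_)
    rw [norm_smul]
    refine mul_le_mul_of_nonneg_left (mD_norm _ _ ?_) (norm_nonneg _)
    simpa using (mem_ball_zero_iff.mp hy).le
  exact this.congr (fun x hx => (series_hasFDerivAt P Q b hb hb' (mem_ball_zero_iff.mp hx)).fderiv)

end series

section hom
variable {l₁ l₂ l ε : ℂ} {c : ℝ} (hc : 0 < c) (hd : Div l₁ l₂ l c)

/-- coefficients of the solution -/
noncomputable def bc (l₁ l₂ l : ℂ) (g : WA) (n : Idx) : ℂ :=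
  if 2 ≤ deg n then co g n * (dv l₁ l₂ l n)⁻¹ else 0

/-- the solution as a function -/
noncomputable def hfun (l₁ l₂ l : ℂ) (g : WA) (x : ℂ × ℂ) : ℂ :=
  ∑' n : Idx, bc l₁ l₂ l g n * (x.1 ^ n 0 * x.2 ^ n 1)

include hc hd

lemma bc_le (g : WA) (n : Idx) : ‖bc l₁ l₂ l g n‖ * ((n 0 : ℝ) + n 1) ≤ ‖co g n‖ * c⁻¹ := by
  unfold bc
  split_ifs with h
  · have := inv_le hc hd n h
    rw [norm_mul, mul_assoc]
    refine mul_le_mul_of_nonneg_left ?_ (norm_nonneg _)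
    simp only [deg, Nat.cast_add] at this
    linarith
  · simp; positivity

lemma bc_summable' (g : WA) : Summable (fun n => ‖bc l₁ l₂ l g n‖ * ((n 0 : ℝ) + n 1)) :=
  ((summable_co g).mul_right c⁻¹).of_nonneg_of_le (fun n => by positivity) (bc_le hc hd g)

lemma bc_summable (g : WA) : Summable (fun n => ‖bc l₁ l₂ l g n‖) := by
  refine (bc_summable' hc hd g).of_nonneg_of_le (fun n => by positivity) (fun n => ?_)
  by_cases h : 2 ≤ deg n
  · refine le_mul_of_one_le_right (norm_nonneg _) ?_
    simp only [deg] at h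
    exact_mod_cast (by omega : 1 ≤ n 0 + n 1)
  · simp [bc, h]

lemma hfun_eq_ev (g : WA) (x : ℂ × ℂ) (hx : ‖x‖ ≤ 1) :
    ev x hx (op (vS l₁ l₂ l) c⁻¹ (vS_le hc hd) g) = hfun l₁ l₂ l g x := by
  rw [op_apply, (ev x hx).map_tsum (op_summable _ _ (vS_le hc hd) g).of_norm, hfun]
  congr 1
  ext n
  rw [map_smul, vS, bc]
  split_ifs with h
  · rw [map_smul, ev_mon, m, smul_eq_mul, smul_eq_mul]; ring
  · simp

lemma K_ev (g : WA) (x : ℂ × ℂ) (hx : ‖x‖ ≤ 1) :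
    HasSum (fun n => bc l₁ l₂ l g n * (n 0 * (x.1 ^ (n 0 - 1) * x.2 ^ (n 1 + 1))))
    (ev x hx (op (vK l₁ l₂ l) c⁻¹ (vK_le hc hd) g)) := by
  rw [op_apply]
  have := (op_summable _ _ (vK_le hc hd) g).of_norm.hasSum.mapL (ev x hx)
  convert this using 1
  ext n
  rw [map_smul, vK, bc]
  split_ifs with h
  · rw [map_smul, ev_mon, m, smul_eq_mul, smul_eq_mul]
    have e1 : (n - i0 + i1) 0 = n 0 - 1 := by simp [i0, i1]
    have e2 : (n - i0 + i1) 1 = n 1 + 1 := by simp [i0, i1]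
    rw [e1, e2]; ring
  · simp

lemma hfun_hasFDerivAt (g : WA) {x : ℂ × ℂ} (hx : ‖x‖ < 1) :
    HasFDerivAt (hfun l₁ l₂ l g) (∑' n : Idx, bc l₁ l₂ l g n • mD (n 0) (n 1) x) x :=
  series_hasFDerivAt (fun n : Idx => n 0) (fun n => n 1) (bc l₁ l₂ l g)
    (bc_summable hc hd g) (bc_summable' hc hd g) hx

lemma hfun_contDiffOn (g : WA) : ContDiffOn ℂ 1 (hfun l₁ l₂ l g) (Metric.ball 0 1) :=
  series_contDiffOn (fun n : Idx => n 0) (fun n => n 1) (bc l₁ l₂ l g)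
    (bc_summable hc hd g) (bc_summable' hc hd g)

omit hc hd in
lemma hfun_zero (g : WA) : hfun l₁ l₂ l g 0 = 0 := by
  unfold hfun
  convert tsum_zero with n
  unfold bc
  split_ifs with h
  · simp only [deg] at h
    have : n 0 ≠ 0 ∨ n 1 ≠ 0 := by omega
    rcases this with h | h <;> simp [h]
  · simp

lemma hfun_deriv_zero (g : WA) : HasFDerivAt (hfun l₁ l₂ l g) (0 : ℂ × ℂ →L[ℂ] ℂ) 0 := by
  refine (hfun_hasFDerivAt hc hd g (x := 0) (by simp)).congr_fderiv ?_
  have key : ∀ n : Idx, bc l₁ l₂ l g n • mD (n 0) (n 1) 0 = 0 := by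
    intro n
    refine ContinuousLinearMap.ext (fun v => ?_)
    change bc l₁ l₂ l g n * mD (n 0) (n 1) 0 v = 0
    by_cases h : 2 ≤ deg n
    · simp only [deg] at h
      rw [mD_apply]
      have h1 : n 1 ≠ 0 ∨ n 0 - 1 ≠ 0 := by omega
      have h2 : n 0 ≠ 0 ∨ n 1 - 1 ≠ 0 := by omega
      rcases h1 with h1 | h1 <;> rcases h2 with h2 | h2 <;> simp [h1, h2]
    · rw [bc, if_neg h, zero_mul]
  simp only [key, tsum_zero]

lemma hfun_homological (g : WA) (hg : Ord 2 g) {x : ℂ × ℂ} (hx : ‖x‖ < 1) :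
    (∑' n : Idx, bc l₁ l₂ l g n • mD (n 0) (n 1) x) (l₁ * x.1 + ε * x.2, l₂ * x.2) =
      ev x hx.le g + l * hfun l₁ l₂ l g x +
        ε * ev x hx.le (op (vK l₁ l₂ l) c⁻¹ (vK_le hc hd) g) := by
  have s1 := (mD_summable (fun n : Idx => n 0) (fun n => n 1) (bc l₁ l₂ l g)
    (bc_summable' hc hd g) hx.le).hasSum.mapL
    (ContinuousLinearMap.apply ℂ ℂ ((l₁ * x.1 + ε * x.2, l₂ * x.2) : ℂ × ℂ))
  have s2 : HasSum (fun n => co g n * m n x) (ev x hx.le g) := (ev_summable x hx.le g).of_norm.hasSum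
  have s3 : HasSum (fun n => bc l₁ l₂ l g n * (x.1 ^ n 0 * x.2 ^ n 1)) (hfun l₁ l₂ l g x) := by
    refine (Summable.of_norm_bounded (bc_summable hc hd g) (fun n => ?_)).hasSum
    rw [norm_mul]
    exact mul_le_of_le_one_right (norm_nonneg _) (norm_m_le n hx.le)
  have s4 := (s2.add (s3.mul_left l)).add ((K_ev hc hd g x hx.le).mul_left ε)
  refine HasSum.unique ?_ s4
  rw [ContinuousLinearMap.apply_apply] at s1
  refine (congrArg (fun f => HasSum f _ _) (funext fun n => ?_)).mp s1
  simp only [ContinuousLinearMap.apply_apply, smul_apply, mD_apply, smul_eq_mul]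
  by_cases h : 2 ≤ deg n
  · have hb : co g n = bc l₁ l₂ l g n * dv l₁ l₂ l n := by
      have := dv_ne hc hd n h
      simp only [bc, if_pos h]
      field_simp
    rw [hb, m, dv]
    rcases hn0 : n 0 with _ | i <;> rcases hn1 : n 1 with _ | j <;>
      (try simp only [Nat.add_sub_cancel]) <;> push_cast <;> ring
  · simp [bc, h, hg n (by omega)]

end hom

theorem core {l₁ l₂ ε : ℂ} {c : ℝ} (hc : 0 < c) (hd1 : Div l₁ l₂ l₁ c) (hd2 : Div l₁ l₂ l₂ c)
    (hε : ‖ε‖ ≤ c / 8) {a b : ℕ × ℕ → ℂ} {κ₁ κ₂ : ℝ}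
    (ha0 : ∀ p : ℕ × ℕ, p.1 + p.2 < 2 → a p = 0) (hb0 : ∀ p : ℕ × ℕ, p.1 + p.2 < 2 → b p = 0)
    (ha : HasSum (fun p => ‖a p‖ * wt p) κ₁) (hb : HasSum (fun p => ‖b p‖ * wt p) κ₂)
    (hκ₁ : κ₁ ≤ c / 4) (hκ₂ : κ₂ ≤ c / 4) (F : ℂ × ℂ → ℂ × ℂ)
    (hF : ∀ y : ℂ × ℂ, ‖y‖ ≤ 2 → F y =
      (l₁ * y.1 + ε * y.2 + ∑' p : ℕ × ℕ, a p * (y.1 ^ p.1 * y.2 ^ p.2),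
       l₂ * y.2 + ∑' p : ℕ × ℕ, b p * (y.1 ^ p.1 * y.2 ^ p.2))) :
    ∃ Ψ : ℂ × ℂ → ℂ × ℂ, Ψ 0 = 0 ∧ ContDiffOn ℂ 1 Ψ (Metric.ball 0 1) ∧
      HasFDerivAt Ψ (ContinuousLinearMap.id ℂ (ℂ × ℂ)) 0 ∧
      ∀ x ∈ Metric.ball (0 : ℂ × ℂ) 1,
        fderiv ℂ Ψ x (l₁ * x.1 + ε * x.2, l₂ * x.2) = F (Ψ x) := by
  obtain ⟨g₁, g₂, h₁, h₂, eh₁, eh₂, n₁, n₂, o₁, o₂, e₁, e₂⟩ :=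
    exists_fixed hc hd1 hd2 hε ha0 hb0 ha hb hκ₁ hκ₂
  have small : ∀ (k : Idx) (h : WA), ‖h‖ ≤ 1 → ‖mon k + h‖ ≤ 2 := fun k h hh =>
    (norm_add_le _ _).trans (by rw [norm_mon]; linarith)
  refine ⟨fun x => (x.1 + hfun l₁ l₂ l₁ g₁ x, x.2 + hfun l₁ l₂ l₂ g₂ x), ?_, ?_, ?_, ?_⟩
  · simp [hfun_zero]
  · exact (contDiff_fst.contDiffOn.add (hfun_contDiffOn hc hd1 g₁)).prodMk
      (contDiff_snd.contDiffOn.add (hfun_contDiffOn hc hd2 g₂))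
  · have h1 : HasFDerivAt (fun x : ℂ × ℂ => x.1) (ContinuousLinearMap.fst ℂ ℂ ℂ) 0 := hasFDerivAt_fst
    have h2 : HasFDerivAt (fun x : ℂ × ℂ => x.2) (ContinuousLinearMap.snd ℂ ℂ ℂ) 0 := hasFDerivAt_snd
    refine ((h1.add (hfun_deriv_zero hc hd1 g₁)).prodMk
      (h2.add (hfun_deriv_zero hc hd2 g₂))).congr_fderiv ?_
    refine ContinuousLinearMap.ext (fun v => ?_)
    simp
  · intro x hx
    rw [mem_ball_zero_iff] at hx
    have h1 : HasFDerivAt (fun x : ℂ × ℂ => x.1) (ContinuousLinearMap.fst ℂ ℂ ℂ) x := hasFDerivAt_fst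
    have h2 : HasFDerivAt (fun x : ℂ × ℂ => x.2) (ContinuousLinearMap.snd ℂ ℂ ℂ) x := hasFDerivAt_snd
    have D := (h1.add (hfun_hasFDerivAt hc hd1 g₁ hx)).prodMk (h2.add (hfun_hasFDerivAt hc hd2 g₂ hx))
    have E1 := congrArg (ev x hx.le) e₁
    have E2 := congrArg (ev x hx.le) e₂
    have X1 : ev x hx.le (mon i0 + h₁) = x.1 + hfun l₁ l₂ l₁ g₁ x := by
      rw [map_add, eh₁, hfun_eq_ev hc hd1, ev_mon]; simp [m, i0]
    have X2 : ev x hx.le (mon i1 + h₂) = x.2 + hfun l₁ l₂ l₂ g₂ x := by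
      rw [map_add, eh₂, hfun_eq_ev hc hd2, ev_mon]; simp [m, i1]
    have nX := small i0 _ n₁
    have nY := small i1 _ n₂
    rw [map_sub, map_smul, map_sub, Fs_ev ha0 ha nX nY x hx.le, X1, X2, smul_eq_mul] at E1
    rw [map_sub, map_smul, Fs_ev hb0 hb nX nY x hx.le, X1, X2, smul_eq_mul] at E2
    have H2 : ev x hx.le h₂ = hfun l₁ l₂ l₂ g₂ x := by rw [eh₂, hfun_eq_ev hc hd2]
    have b1 : ‖x.1 + hfun l₁ l₂ l₁ g₁ x‖ ≤ 2 := by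
      rw [← X1]; exact (ev_norm_le _ _ _).trans nX
    have b2 : ‖x.2 + hfun l₁ l₂ l₂ g₂ x‖ ≤ 2 := by
      rw [← X2]; exact (ev_norm_le _ _ _).trans nY
    have key1 := hfun_homological (ε := ε) hc hd1 g₁ o₁ hx
    have key2 := hfun_homological (ε := ε) hc hd2 g₂ o₂ hx
    rw [hF _ (norm_prod_le_iff.mpr ⟨b1, b2⟩)]
    have D' := D.fderiv
    simp only [Pi.add_apply] at D'
    change fderiv ℂ (fun x => (x.1 + hfun l₁ l₂ l₁ g₁ x, x.2 + hfun l₁ l₂ l₂ g₂ x)) x = _ at D'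
    rw [D']
    simp only [ContinuousLinearMap.prod_apply, add_apply, key1, key2,
      ContinuousLinearMap.coe_fst', ContinuousLinearMap.coe_snd']
    rw [E1, E2, H2]
    refine Prod.ext ?_ ?_
    · simp only; ring
    · simp only; ring

end PL

namespace PL
open Filter Topology

/-- Taylor coefficient in the first variable. -/
noncomputable def cm (G : ℂ × ℂ → ℂ) (m : ℕ) (w : ℂ) : ℂ :=
  ((m.factorial : ℂ))⁻¹ * iteratedDeriv m (fun z => G (z, w)) 0

lemma slice_diff {G : ℂ × ℂ → ℂ} {R : ℝ} (hG : DifferentiableOn ℂ G (Metric.ball 0 R))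
    {w : ℂ} (hw : ‖w‖ < R) : DifferentiableOn ℂ (fun z => G (z, w)) (Metric.ball 0 R) := by
  refine hG.comp (f := fun z : ℂ => (z, w)) (by fun_prop) ?_
  intro z hz
  simp only [Metric.mem_ball, dist_zero_right] at hz ⊢
  simpa [Prod.norm_def] using ⟨hz, hw⟩

lemma slice_diff' {G : ℂ × ℂ → ℂ} {R : ℝ} (hG : DifferentiableOn ℂ G (Metric.ball 0 R))
    {z : ℂ} (hz : ‖z‖ < R) : DifferentiableOn ℂ (fun w => G (z, w)) (Metric.ball 0 R) := by
  refine hG.comp (f := fun w : ℂ => (z, w)) (by fun_prop) ?_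
  intro w hw
  simp only [Metric.mem_ball, dist_zero_right] at hw ⊢
  simpa [Prod.norm_def] using ⟨hz, hw⟩

lemma coef_bound {f : ℂ → ℂ} {R s M : ℝ} (hs : 0 < s) (hsR : s < R)
    (hf : DifferentiableOn ℂ f (Metric.ball 0 R)) (hM : ∀ z, ‖z‖ ≤ s → ‖f z‖ ≤ M) (m : ℕ) :
    ‖((m.factorial : ℂ))⁻¹ * iteratedDeriv m f 0‖ ≤ M / s ^ m := by
  have hd : DiffContOnCl ℂ f (Metric.ball 0 s) := by
    apply DifferentiableOn.diffContOnCl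
    rw [closure_ball _ hs.ne']
    exact hf.mono (Metric.closedBall_subset_ball hsR)
  have := Complex.norm_iteratedDeriv_le_of_forall_mem_sphere_norm_le m hs hd
    (C := M) (fun z hz => hM z (by simpa using hz.le))
  rw [norm_mul, norm_inv, Complex.norm_natCast]
  have h0 : (0 : ℝ) < m.factorial := by exact_mod_cast m.factorial_pos
  rw [inv_mul_le_iff₀ h0]
  rwa [mul_div_assoc] at this

lemma coef_hasSum {f : ℂ → ℂ} {R : ℝ}
    (hf : DifferentiableOn ℂ f (Metric.ball 0 R)) {z : ℂ} (hz : ‖z‖ < R) :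
    HasSum (fun m : ℕ => ((m.factorial : ℂ))⁻¹ * iteratedDeriv m f 0 * z ^ m) (f z) := by
  have := Complex.hasSum_taylorSeries_on_ball hf (z := z) (by simpa using hz)
  refine this.congr_fun ?_ 
  intro m
  simp only [sub_zero, smul_eq_mul]
  ring

lemma rem_bound {c : ℕ → ℂ} {g : ℂ} {s M q : ℝ} (hs : 0 < s) (hq : 0 < q) (hq2 : q ≤ 1 / 2)
    (hc : ∀ m, ‖c m‖ ≤ M / s ^ m) (hg : HasSum (fun m => c m * ((s * q : ℝ) : ℂ) ^ m) g) (m : ℕ) :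
    ‖c m - (g - ∑ k ∈ Finset.range m, c k * ((s * q : ℝ) : ℂ) ^ k) / ((s * q : ℝ) : ℂ) ^ m‖
      ≤ 2 * M / s ^ m * q := by
  set t : ℂ := ((s * q : ℝ) : ℂ) with ht
  have ht0 : t ≠ 0 := by rw [ht]; exact_mod_cast (mul_pos hs hq).ne'
  have htn : ‖t‖ = s * q := by rw [ht, Complex.norm_real, Real.norm_of_nonneg (by positivity)]
  have hM : 0 ≤ M := by have := (norm_nonneg _).trans (hc 0); simpa using this
  have h1 := (hasSum_nat_add_iff' (m + 1)).2 hg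
  have h2 : HasSum (fun k : ℕ => M * q ^ (m + 1) * q ^ k) (M * q ^ (m + 1) * (1 - q)⁻¹) :=
    (hasSum_geometric_of_lt_one hq.le (by linarith)).mul_left _
  have h3 := h1.norm_le_of_bounded h2 (fun k => by
    rw [norm_mul, norm_pow, htn]
    calc _ ≤ M / s ^ (k + (m + 1)) * (s * q) ^ (k + (m + 1)) := by gcongr; exact hc _
      _ = _ := by field_simp; ring)
  have h4 : c m - (g - ∑ k ∈ Finset.range m, c k * t ^ k) / t ^ m =
      - (g - ∑ k ∈ Finset.range (m + 1), c k * t ^ k) / t ^ m := by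
    rw [Finset.sum_range_succ]; field_simp; ring
  rw [h4, norm_div, norm_neg, norm_pow, htn, div_le_iff₀ (by positivity)]
  refine h3.trans ?_
  have h5 : (1 - q)⁻¹ ≤ 2 := by
    rw [inv_le_comm₀ (by linarith) (by norm_num)]; linarith
  calc _ ≤ M * q ^ (m + 1) * 2 := by gcongr
    _ = _ := by rw [mul_pow]; field_simp; ring

lemma cm_diff {G : ℂ × ℂ → ℂ} {R s M : ℝ} (hG : DifferentiableOn ℂ G (Metric.ball 0 R))
    (hs : 0 < s) (hsR : s < R) (hM : ∀ y, ‖y‖ ≤ s → ‖G y‖ ≤ M) (m : ℕ) :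
    DifferentiableOn ℂ (cm G m) (Metric.ball 0 s) := by
  induction m using Nat.strong_induction_on with
  | _ m ih =>
  have hM0 : 0 ≤ M := (norm_nonneg _).trans (hM 0 (by simpa using hs.le))
  let q : ℕ → ℝ := fun j => 1 / ((j : ℝ) + 1 + 1)
  have hq0 : ∀ j, 0 < q j := fun j => by positivity
  have hq2 : ∀ j, q j ≤ 1 / 2 := fun j => by
    apply one_div_le_one_div_of_le (by norm_num)
    have : (0 : ℝ) ≤ j := by positivity
    linarith
  have hqt : Tendsto q atTop (𝓝 0) := by
    have := (tendsto_one_div_add_atTop_nhds_zero_nat (𝕜 := ℝ)).comp (tendsto_add_atTop_nat 1)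
    refine this.congr (fun j => ?_)
    simp [q]
  have hsq : ∀ j, ‖((s * q j : ℝ) : ℂ)‖ < R := fun j => by
    rw [Complex.norm_real, Real.norm_of_nonneg (mul_pos hs (hq0 j)).le]
    nlinarith [hq2 j, hq0 j]
  have hU : TendstoUniformlyOn (fun (j : ℕ) (w : ℂ) =>
      (G (((s * q j : ℝ) : ℂ), w) - ∑ k ∈ Finset.range m, cm G k w * ((s * q j : ℝ) : ℂ) ^ k)
        / ((s * q j : ℝ) : ℂ) ^ m) (cm G m) atTop (Metric.ball 0 s) := by
    rw [Metric.tendstoUniformlyOn_iff]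
    intro e he
    have ht : Tendsto (fun j => 2 * M / s ^ m * q j) atTop (𝓝 0) := by
      simpa using hqt.const_mul (2 * M / s ^ m)
    filter_upwards [ht.eventually (gt_mem_nhds he)] with j hj w hw
    have hw' : ‖w‖ < s := by simpa using hw
    rw [dist_eq_norm]
    refine lt_of_le_of_lt (rem_bound (c := fun k => cm G k w) hs (hq0 j) (hq2 j) (fun k => ?_) ?_ m) hj
    · exact coef_bound hs hsR (slice_diff hG (hw'.trans hsR)) (fun z hz => hM _ (by
        simpa [Prod.norm_def] using ⟨hz, hw'.le⟩)) k
    · exact coef_hasSum (slice_diff hG (hw'.trans hsR)) (hsq j)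
  refine hU.tendstoLocallyUniformlyOn.differentiableOn (Eventually.of_forall fun j => ?_)
    Metric.isOpen_ball
  refine DifferentiableOn.div_const (DifferentiableOn.sub ?_ ?_) _
  · exact (slice_diff' hG (hsq j)).mono (Metric.ball_subset_ball hsR.le)
  · refine DifferentiableOn.fun_sum (fun k hk => ?_)
    exact (ih k (Finset.mem_range.1 hk)).mul_const _

theorem taylor2 {G : ℂ × ℂ → ℂ} {R : ℝ} (hR : 0 < R)
    (hG : DifferentiableOn ℂ G (Metric.ball 0 R)) :
    ∃ ρ > 0, ∃ M ≥ 0, ∃ c : ℕ × ℕ → ℂ, (∀ p, ‖c p‖ ≤ M / ρ ^ (p.1 + p.2)) ∧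
      ρ < R ∧ ∀ y : ℂ × ℂ, ‖y‖ < ρ → HasSum (fun p => c p * (y.1 ^ p.1 * y.2 ^ p.2)) (G y) := by
  obtain ⟨M, hM⟩ := (isCompact_closedBall (0 : ℂ × ℂ) (R / 2)).exists_bound_of_continuousOn
    (hG.continuousOn.mono (Metric.closedBall_subset_ball (by linarith)))
  have hM' : ∀ y, ‖y‖ ≤ R / 2 → ‖G y‖ ≤ M := fun y hy => hM y (by simpa using hy)
  have hM0 : 0 ≤ M := (norm_nonneg _).trans (hM' 0 (by simp; linarith))
  have hs : 0 < R / 2 := by linarith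
  have hsR : R / 2 < R := by linarith
  have hρ : 0 < R / 4 := by linarith
  have hcb : ∀ m w, ‖w‖ < R / 2 → ‖cm G m w‖ ≤ M / (R / 2) ^ m := fun m w hw =>
    coef_bound hs hsR (slice_diff hG (hw.trans hsR)) (fun z hz => hM' _ (by
        simpa [Prod.norm_def] using ⟨hz, hw.le⟩)) m
  let c : ℕ × ℕ → ℂ := fun p => ((p.2.factorial : ℂ))⁻¹ * iteratedDeriv p.2 (cm G p.1) 0
  have hc : ∀ p, ‖c p‖ ≤ M / (R / 4) ^ (p.1 + p.2) := fun p => by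
    have := coef_bound hρ (show R / 4 < R / 2 by linarith) (cm_diff hG hs hsR hM' p.1)
      (M := M / (R / 2) ^ p.1) (fun w hw => hcb _ _ (by linarith)) p.2
    refine this.trans ?_
    rw [div_div, pow_add]
    gcongr
    linarith
  refine ⟨R / 4, hρ, M, hM0, c, hc, by linarith, fun y hy => ?_⟩
  have hy1 : ‖y.1‖ < R / 4 := (norm_fst_le y).trans_lt hy
  have hy2 : ‖y.2‖ < R / 4 := (norm_snd_le y).trans_lt hy
  have hsum : Summable (fun p : ℕ × ℕ => c p * (y.1 ^ p.1 * y.2 ^ p.2)) := by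
    have h1 : Summable (fun n : ℕ => (‖y.1‖ / (R / 4)) ^ n) :=
      summable_geometric_of_lt_one (by positivity) (by rwa [div_lt_one hρ])
    have h2 : Summable (fun n : ℕ => (‖y.2‖ / (R / 4)) ^ n) :=
      summable_geometric_of_lt_one (by positivity) (by rwa [div_lt_one hρ])
    have h3 := (h1.mul_of_nonneg h2 (fun _ => by positivity) (fun _ => by positivity)).mul_left M
    refine Summable.of_norm_bounded h3 (fun p => ?_)
    rw [norm_mul (c p), norm_mul (y.1 ^ p.1), norm_pow, norm_pow]
    calc _ ≤ M / (R / 4) ^ (p.1 + p.2) * (‖y.1‖ ^ p.1 * ‖y.2‖ ^ p.2) := by gcongr; exact hc p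
      _ = _ := by 
        have hne := hρ.ne'
        generalize R / 4 = r at hne
        rw [div_pow, div_pow, pow_add]; field_simp
  have hf : ∀ m, HasSum (fun n => c (m, n) * (y.1 ^ m * y.2 ^ n)) (cm G m y.2 * y.1 ^ m) := by
    intro m
    have := (coef_hasSum (cm_diff hG hs hsR hM' m) (z := y.2) (by linarith)).mul_right (y.1 ^ m)
    refine this.congr_fun (fun n => ?_)
    simp only [c]; ring
  have h4 := hsum.hasSum.prod_fiberwise hf
  have h5 := coef_hasSum (slice_diff hG (w := y.2) (by linarith)) (z := y.1) (by linarith)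
  rw [show G y = ∑' p : ℕ × ℕ, c p * (y.1 ^ p.1 * y.2 ^ p.2) from h5.unique h4]
  exact hsum.hasSum
end PL

namespace PL
open Filter Topology

lemma scaled {G : ℂ × ℂ → ℂ} {R : ℝ} (hR : 0 < R)
    (hG : DifferentiableOn ℂ G (Metric.ball 0 R)) (hG0 : G 0 = 0) {α β : ℂ}
    {D : ℂ × ℂ →L[ℂ] ℂ} (hD : HasFDerivAt G D 0) (hD1 : D (1, 0) = α) (hD2 : D (0, 1) = β)
    {κ : ℝ} (hκ : 0 < κ) :
    ∃ r0 > 0, ∀ r : ℝ, 0 < r → r ≤ r0 → ∃ a : ℕ × ℕ → ℂ, ∃ κ' ≤ κ,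
      (∀ p : ℕ × ℕ, p.1 + p.2 < 2 → a p = 0) ∧ HasSum (fun p => ‖a p‖ * wt p) κ' ∧
      ∀ y : ℂ × ℂ, ‖y‖ ≤ 2 → (r : ℂ)⁻¹ * G ((r : ℂ) • y) =
        α * y.1 + β * y.2 + ∑' p : ℕ × ℕ, a p * (y.1 ^ p.1 * y.2 ^ p.2) := by
  obtain ⟨ρ, hρ, M, hM, c, hc, hρR, hs⟩ := taylor2 hR hG
  refine ⟨min (ρ / 8) (κ * ρ ^ 2 / (256 * (M + 1))), by positivity, fun r hr hr0 => ?_⟩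
  have hr1 : r ≤ ρ / 8 := hr0.trans (min_le_left _ _)
  have hr2 : r ≤ κ * ρ ^ 2 / (256 * (M + 1)) := hr0.trans (min_le_right _ _)
  have hrc : (r : ℂ) ≠ 0 := by exact_mod_cast hr.ne'
  have hrn : ‖(r : ℂ)‖ = r := by rw [Complex.norm_real, Real.norm_of_nonneg hr.le]
  set e : ℕ × ℕ → ℂ := fun p => (r : ℂ)⁻¹ * (c p * (r : ℂ) ^ (p.1 + p.2)) with he
  set a : ℕ × ℕ → ℂ := fun p => if p.1 + p.2 < 2 then 0 else e p with ha
  have ha0 : ∀ p : ℕ × ℕ, p.1 + p.2 < 2 → a p = 0 := fun p hp => if_pos hp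
  have ha1 : ∀ p : ℕ × ℕ, ¬ p.1 + p.2 < 2 → a p = e p := fun p hp => if_neg hp
  have hes : ∀ y : ℂ × ℂ, ‖y‖ ≤ 2 →
      HasSum (fun p => e p * (y.1 ^ p.1 * y.2 ^ p.2)) ((r : ℂ)⁻¹ * G ((r : ℂ) • y)) := by
    intro y hy
    have h := (hs ((r : ℂ) • y) (by
      rw [norm_smul, hrn]; nlinarith [norm_nonneg y])).mul_left (r : ℂ)⁻¹
    refine h.congr_fun (fun p => ?_)
    simp only [he, Prod.smul_fst, Prod.smul_snd, smul_eq_mul, mul_pow, pow_add]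
    ring
  have hbd : ∀ p, ‖a p‖ * wt p ≤ 64 * M * r / ρ ^ 2 * ((1 / 2 : ℝ) ^ p.1 * (1 / 2 : ℝ) ^ p.2) := by
    intro p
    by_cases hp : p.1 + p.2 < 2
    · simp only [ha0 p hp, norm_zero, zero_mul]; positivity
    · simp only [ha1 p hp, he, norm_mul, norm_inv, norm_pow, hrn, wt]
      rw [← pow_add]
      have hcast : (p.1 : ℝ) + p.2 = ((p.1 + p.2 : ℕ) : ℝ) := by push_cast; ring
      rw [hcast]
      have hcp := hc p
      obtain ⟨k, hk⟩ : ∃ k, p.1 + p.2 = k + 2 := ⟨p.1 + p.2 - 2, by omega⟩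
      rw [hk] at hcp ⊢
      have hn : ((k + 2 : ℕ) : ℝ) ≤ 2 ^ (k + 2) := by
        exact_mod_cast (Nat.lt_two_pow_self (n := k + 2)).le
      calc r⁻¹ * (‖c p‖ * r ^ (k + 2)) * (((k + 2 : ℕ) : ℝ) * 2 ^ (k + 2))
          ≤ r⁻¹ * (M / ρ ^ (k + 2) * r ^ (k + 2)) * (2 ^ (k + 2) * 2 ^ (k + 2)) := by gcongr
        _ = M * r / ρ ^ 2 * 16 * (4 * (r / ρ)) ^ k := by
            rw [mul_pow, div_pow, show (4 : ℝ) = 2 * 2 by norm_num, mul_pow]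
            field_simp
            ring
        _ ≤ M * r / ρ ^ 2 * 16 * (1 / 2) ^ k := by
            gcongr
            have : r / ρ ≤ 1 / 8 := by rw [div_le_iff₀ hρ]; linarith
            linarith
        _ = _ := by ring
  have hgeo : HasSum (fun p : ℕ × ℕ => (1 / 2 : ℝ) ^ p.1 * (1 / 2 : ℝ) ^ p.2) (2 * 2) :=
    hasSum_geometric_two.mul hasSum_geometric_two
      (summable_geometric_two.mul_of_nonneg summable_geometric_two
        (fun _ => by positivity) (fun _ => by positivity))
  have hgeo' := hgeo.mul_left (64 * M * r / ρ ^ 2)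
  have hsw : Summable (fun p => ‖a p‖ * wt p) :=
    Summable.of_nonneg_of_le (fun p => mul_nonneg (norm_nonneg _) (wt_nonneg p)) hbd hgeo'.summable
  have hκ' : ∑' p, ‖a p‖ * wt p ≤ κ := by
    refine (hsw.tsum_le_tsum hbd hgeo'.summable).trans ?_
    rw [hgeo'.tsum_eq]
    rw [le_div_iff₀ (by positivity)] at hr2
    rw [div_mul_eq_mul_div, div_le_iff₀ (by positivity)]
    nlinarith
  have hwge : ∀ p : ℕ × ℕ, ‖a p‖ * ((p.1 : ℝ) + p.2) ≤ ‖a p‖ * wt p := fun p => by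
    refine mul_le_mul_of_nonneg_left ?_ (norm_nonneg _)
    exact le_mul_of_one_le_right (by positivity) (one_le_pow₀ (by norm_num))
  have hb' : Summable (fun p => ‖a p‖ * ((p.1 : ℝ) + p.2)) :=
    Summable.of_nonneg_of_le (fun p => by positivity) hwge hsw
  have hb : Summable (fun p => ‖a p‖) := by
    refine Summable.of_nonneg_of_le (fun p => by positivity) (fun p => ?_) hb'
    by_cases hp : p.1 + p.2 < 2
    · simp [ha0 p hp]
    · refine le_mul_of_one_le_right (norm_nonneg _) ?_
      have : 2 ≤ p.1 + p.2 := by omega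
      have h2 : (2 : ℝ) ≤ (p.1 : ℝ) + p.2 := by exact_mod_cast this
      linarith
  have hsplit : ∀ y : ℂ × ℂ, ‖y‖ ≤ 2 → (r : ℂ)⁻¹ * G ((r : ℂ) • y) =
        (e (0, 0) + e (1, 0) * y.1 + e (0, 1) * y.2)
          + ∑' p : ℕ × ℕ, a p * (y.1 ^ p.1 * y.2 ^ p.2) := by
    intro y hy
    have h1 : HasSum (fun p => (e p - a p) * (y.1 ^ p.1 * y.2 ^ p.2))
        (∑ p ∈ ({(0, 0), (1, 0), (0, 1)} : Finset (ℕ × ℕ)),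
          (e p - a p) * (y.1 ^ p.1 * y.2 ^ p.2)) := by
      refine hasSum_sum_of_ne_finset_zero (fun p hp => ?_)
      have : ¬ p.1 + p.2 < 2 := by
        intro h
        apply hp
        obtain ⟨i, j⟩ := p
        simp only [Finset.mem_insert, Finset.mem_singleton, Prod.mk.injEq]
        simp only at h
        omega
      simp [ha1 p this]
    have h2 := (hes y hy).sub h1
    have h3 : (∑ p ∈ ({(0, 0), (1, 0), (0, 1)} : Finset (ℕ × ℕ)),
          (e p - a p) * (y.1 ^ p.1 * y.2 ^ p.2)) = e (0, 0) + e (1, 0) * y.1 + e (0, 1) * y.2 := by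
      rw [Finset.sum_insert (by decide), Finset.sum_insert (by decide), Finset.sum_singleton]
      simp [ha0 (0, 0), ha0 (1, 0), ha0 (0, 1)]; ring
    rw [h3] at h2
    have h4 : HasSum (fun p => a p * (y.1 ^ p.1 * y.2 ^ p.2)) ((r : ℂ)⁻¹ * G ((r : ℂ) • y)
        - (e (0, 0) + e (1, 0) * y.1 + e (0, 1) * y.2)) :=
      h2.congr_fun (fun p => by ring)
    rw [h4.tsum_eq]; ring
  have ht0 : ∑' p : ℕ × ℕ, a p * ((0 : ℂ × ℂ).1 ^ p.1 * (0 : ℂ × ℂ).2 ^ p.2) = 0 := by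
    refine (tsum_congr (fun p => ?_)).trans tsum_zero
    obtain ⟨i, j⟩ := p
    rcases Nat.eq_zero_or_pos i with h | h
    · rcases Nat.eq_zero_or_pos j with h' | h'
      · simp [h, h', ha0 (0, 0)]
      · simp [h'.ne']
    · simp [h.ne']
  have he0 : e (0, 0) = 0 := by
    have := hsplit 0 (by simp)
    rw [ht0] at this
    simpa [hG0] using this.symm
  have hT := series_hasFDerivAt (fun p : ℕ × ℕ => p.1) (fun p => p.2) a hb hb'
    (x := 0) (by simp)
  have hT0 : (∑' p : ℕ × ℕ, a p • mD p.1 p.2 0) = 0 := by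
    refine (tsum_congr (fun p => ?_)).trans tsum_zero
    by_cases hp : p.1 + p.2 < 2
    · refine ContinuousLinearMap.ext (fun v => ?_)
      change a p * mD p.1 p.2 0 v = 0
      rw [ha0 p hp, zero_mul]
    · refine ContinuousLinearMap.ext (fun v => ?_)
      change a p * mD p.1 p.2 0 v = 0
      rw [mD_apply]
      obtain ⟨i, j⟩ := p
      rcases i with _ | _ | i <;> rcases j with _ | _ | j <;> simp at hp ⊢
  rw [hT0] at hT
  have hL : HasFDerivAt (fun y : ℂ × ℂ => e (0, 0) + e (1, 0) * y.1 + e (0, 1) * y.2)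
      (e (1, 0) • ContinuousLinearMap.fst ℂ ℂ ℂ + e (0, 1) • ContinuousLinearMap.snd ℂ ℂ ℂ) 0 :=
    ((hasFDerivAt_fst.const_mul _).const_add _).add (hasFDerivAt_snd.const_mul _)
  have hsum := hL.add hT
  have hG' : HasFDerivAt (fun y : ℂ × ℂ => (r : ℂ)⁻¹ * G ((r : ℂ) • y))
      ((r : ℂ)⁻¹ • (D.comp ((r : ℂ) • ContinuousLinearMap.id ℂ (ℂ × ℂ)))) 0 := by
    have h1 : HasFDerivAt (fun y : ℂ × ℂ => (r : ℂ) • y)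
      ((r : ℂ) • ContinuousLinearMap.id ℂ (ℂ × ℂ)) 0 :=
      ((r : ℂ) • ContinuousLinearMap.id ℂ (ℂ × ℂ)).hasFDerivAt
    have h2 : HasFDerivAt G D ((fun y : ℂ × ℂ => (r : ℂ) • y) 0) := by simpa using hD
    exact (h2.comp (0 : ℂ × ℂ) h1).const_mul _
  have hev : (fun y : ℂ × ℂ => (r : ℂ)⁻¹ * G ((r : ℂ) • y)) =ᶠ[𝓝 0]
      (fun y : ℂ × ℂ => (e (0, 0) + e (1, 0) * y.1 + e (0, 1) * y.2)
          + ∑' p : ℕ × ℕ, a p * (y.1 ^ p.1 * y.2 ^ p.2)) := by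
    filter_upwards [Metric.closedBall_mem_nhds (0 : ℂ × ℂ) (show (0 : ℝ) < 2 by norm_num)] with y hy
    exact hsplit y (by simpa using hy)
  have huniq := hG'.unique (hsum.congr_of_eventuallyEq hev)
  have h1 : e (1, 0) = α := by
    have := congrArg (fun T : ℂ × ℂ →L[ℂ] ℂ => T (1, 0)) huniq
    change (r : ℂ)⁻¹ * D ((r : ℂ) • (1, 0)) = e (1, 0) * 1 + e (0, 1) * 0 + 0 at this
    rw [map_smul, hD1, smul_eq_mul, inv_mul_cancel_left₀ hrc] at this
    simpa using this.symm
  have h2 : e (0, 1) = β := by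
    have := congrArg (fun T : ℂ × ℂ →L[ℂ] ℂ => T (0, 1)) huniq
    change (r : ℂ)⁻¹ * D ((r : ℂ) • (0, 1)) = e (1, 0) * 0 + e (0, 1) * 1 + 0 at this
    rw [map_smul, hD2, smul_eq_mul, inv_mul_cancel_left₀ hrc] at this
    simpa using this.symm
  refine ⟨a, _, hκ', ha0, hsw.hasSum, fun y hy => ?_⟩
  rw [hsplit y hy, he0, h1, h2, zero_add]
end PL

namespace PL
open Filter Topology

/-- local linearization for an adapted field -/
theorem core_scaled {l₁ l₂ ε : ℂ} {c : ℝ} (hc : 0 < c) (hd1 : Div l₁ l₂ l₁ c)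
    (hd2 : Div l₁ l₂ l₂ c) (hε : ‖ε‖ ≤ c / 8) {F : ℂ × ℂ → ℂ × ℂ} {U : Set (ℂ × ℂ)}
    (hU : IsOpen U) (h0 : (0 : ℂ × ℂ) ∈ U) (hF : DifferentiableOn ℂ F U) (hF0 : F 0 = 0)
    (hA1 : fderiv ℂ F 0 (1, 0) = (l₁, 0)) (hA2 : fderiv ℂ F 0 (0, 1) = (ε, l₂)) :
    ∃ (Ψ : ℂ × ℂ → ℂ × ℂ) (r : ℝ), 0 < r ∧ Ψ 0 = 0 ∧ ContDiffOn ℂ 1 Ψ (Metric.ball 0 r) ∧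
      HasFDerivAt Ψ (ContinuousLinearMap.id ℂ (ℂ × ℂ)) 0 ∧
      ∀ x ∈ Metric.ball (0 : ℂ × ℂ) r, fderiv ℂ Ψ x (l₁ * x.1 + ε * x.2, l₂ * x.2) = F (Ψ x) := by
  obtain ⟨R, hR, hRU⟩ := Metric.isOpen_iff.1 hU 0 h0
  have hFR := hF.mono hRU
  have hD : HasFDerivAt F (fderiv ℂ F 0) 0 :=
    ((hF 0 h0).differentiableAt (hU.mem_nhds h0)).hasFDerivAt
  obtain ⟨r1, hr1, H1⟩ := scaled hR hFR.fst (by simp [hF0]) hD.fst (α := l₁) (β := ε)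
    (by change (fderiv ℂ F 0 (1, 0)).1 = _; rw [hA1]) (by change (fderiv ℂ F 0 (0, 1)).1 = _; rw [hA2])
    (show 0 < c / 4 by linarith)
  obtain ⟨r2, hr2, H2⟩ := scaled hR hFR.snd (by simp [hF0]) hD.snd (α := 0) (β := l₂)
    (by change (fderiv ℂ F 0 (1, 0)).2 = _; rw [hA1]) (by change (fderiv ℂ F 0 (0, 1)).2 = _; rw [hA2])
    (show 0 < c / 4 by linarith)
  have hr : 0 < min r1 r2 := lt_min hr1 hr2
  obtain ⟨a, κ₁, hκ₁, ha0, ha, hFa⟩ := H1 _ hr (min_le_left _ _)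
  obtain ⟨b, κ₂, hκ₂, hb0, hb, hFb⟩ := H2 _ hr (min_le_right _ _)
  generalize min r1 r2 = r at hr hFa hFb
  have hrc : (r : ℂ) ≠ 0 := by exact_mod_cast hr.ne'
  have hrn : ‖(r : ℂ)‖ = r := by rw [Complex.norm_real, Real.norm_of_nonneg hr.le]
  obtain ⟨Ψ, hΨ0, hΨc, hΨd, hΨe⟩ := core hc hd1 hd2 hε ha0 hb0 ha hb hκ₁ hκ₂
    (fun y => (r : ℂ)⁻¹ • F ((r : ℂ) • y)) (fun y hy => by
      refine Prod.ext ?_ ?_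
      · exact hFa y hy
      · refine (hFb y hy).trans ?_
        rw [zero_mul, zero_add])
  have hin : ∀ x ∈ Metric.ball (0 : ℂ × ℂ) r, (r : ℂ)⁻¹ • x ∈ Metric.ball (0 : ℂ × ℂ) 1 := by
    intro x hx
    simp only [Metric.mem_ball, dist_zero_right] at hx ⊢
    rw [norm_smul, norm_inv, hrn, inv_mul_lt_iff₀ hr]; simpa using hx
  let S : ℂ × ℂ →L[ℂ] ℂ × ℂ := (r : ℂ)⁻¹ • ContinuousLinearMap.id ℂ (ℂ × ℂ)
  have hS : ∀ x, S x = (r : ℂ)⁻¹ • x := fun x => rfl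
  let T : ℂ × ℂ →L[ℂ] ℂ × ℂ := (r : ℂ) • ContinuousLinearMap.id ℂ (ℂ × ℂ)
  have hT : ∀ x, T x = (r : ℂ) • x := fun x => rfl
  have hder : ∀ x L, HasFDerivAt Ψ L (S x) →
      HasFDerivAt (fun x => T (Ψ (S x))) (T.comp (L.comp S)) x := by
    intro x L hL
    exact T.hasFDerivAt.comp x (hL.comp x S.hasFDerivAt)
  refine ⟨fun x => T (Ψ (S x)), r, hr, by simp [hΨ0], ?_, ?_, ?_⟩
  · exact T.contDiff.comp_contDiffOn (hΨc.comp S.contDiff.contDiffOn hin)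
  · have := hder 0 _ (by simpa using hΨd)
    refine this.congr_fderiv (ContinuousLinearMap.ext fun v => ?_)
    change (r : ℂ) • ((r : ℂ)⁻¹ • v) = v
    rw [smul_smul, mul_inv_cancel₀ hrc, one_smul]
  · intro x hx
    have hx1 := hin x hx
    have hdΨ : DifferentiableAt ℂ Ψ (S x) :=
      ((hΨc.differentiableOn one_ne_zero) _ hx1).differentiableAt (Metric.isOpen_ball.mem_nhds hx1)
    rw [(hder x _ hdΨ.hasFDerivAt).fderiv]
    have h := hΨe _ hx1
    change T (fderiv ℂ Ψ (S x) (S (l₁ * x.1 + ε * x.2, l₂ * x.2))) = F (T (Ψ (S x)))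
    have h2 : S (l₁ * x.1 + ε * x.2, l₂ * x.2) =
      (l₁ * ((r : ℂ)⁻¹ • x).1 + ε * ((r : ℂ)⁻¹ • x).2, l₂ * ((r : ℂ)⁻¹ • x).2) := by
      refine Prod.ext ?_ ?_
      · change (r : ℂ)⁻¹ * (l₁ * x.1 + ε * x.2) = l₁ * ((r : ℂ)⁻¹ * x.1) + ε * ((r : ℂ)⁻¹ * x.2)
        ring
      · change (r : ℂ)⁻¹ * (l₂ * x.2) = l₂ * ((r : ℂ)⁻¹ * x.2)
        ring
    rw [h2, hS, h, hT, hT, smul_smul, mul_inv_cancel₀ hrc, one_smul]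

/-- divisor bound -/
theorem exists_div {l₁ l₂ : ℂ} (hP : (0 : ℂ) ∉ segment ℝ l₁ l₂)
    (hN : ∀ i j : ℕ, 2 ≤ i + j → l₁ ≠ i * l₁ + j * l₂ ∧ l₂ ≠ i * l₁ + j * l₂) :
    ∃ c > 0, Div l₁ l₂ l₁ c ∧ Div l₁ l₂ l₂ c := by
  have hcl : IsClosed (segment ℝ l₁ l₂) := by
    rw [← convexHull_pair]
    exact (Set.toFinite {l₁, l₂}).isClosed_convexHull ℝ
  obtain ⟨δ, hδ, hball⟩ := Metric.isOpen_iff.1 hcl.isOpen_compl 0 hP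
  have hlow : ∀ n : Idx, 2 ≤ deg n → δ * deg n ≤ ‖(n 0 : ℂ) * l₁ + (n 1 : ℂ) * l₂‖ := by
    intro n hn
    have hd : (0 : ℝ) < deg n := by exact_mod_cast (by omega : 0 < deg n)
    have hdc : ((deg n : ℝ) : ℂ) ≠ 0 := by exact_mod_cast hd.ne'
    have hdd : (deg n : ℝ) = n 0 + n 1 := by simp [deg]
    have hmem : ((n 0 : ℝ) / deg n) • l₁ + ((n 1 : ℝ) / deg n) • l₂ ∈ segment ℝ l₁ l₂ :=
      ⟨_, _, by positivity, by positivity, by rw [← add_div, ← hdd, div_self hd.ne'], rfl⟩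
    have h1 : δ ≤ ‖((n 0 : ℝ) / deg n) • l₁ + ((n 1 : ℝ) / deg n) • l₂‖ := by
      by_contra hlt
      push Not at hlt
      exact hball (by simpa using hlt) hmem
    have h2 : (n 0 : ℂ) * l₁ + (n 1 : ℂ) * l₂ =
        ((deg n : ℝ) : ℂ) * (((n 0 : ℝ) / deg n) • l₁ + ((n 1 : ℝ) / deg n) • l₂) := by
      simp only [Complex.real_smul]
      push_cast at hdc ⊢
      field_simp
    rw [h2, norm_mul, Complex.norm_real, Real.norm_of_nonneg hd.le, mul_comm]
    gcongr
  have key : ∀ l : ℂ, (∀ i j : ℕ, 2 ≤ i + j → l ≠ i * l₁ + j * l₂) → ∃ c > 0, Div l₁ l₂ l c := by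
    intro l hl
    obtain ⟨N, hN⟩ := exists_nat_gt (2 * ‖l‖ / δ)
    have hNl : 2 * ‖l‖ ≤ δ * N := by rw [div_lt_iff₀ hδ] at hN; linarith
    -- finite part
    have hfin : ∃ c > 0, ∀ i ∈ Finset.range N ×ˢ Finset.range N, 2 ≤ i.1 + i.2 →
        c * ((i.1 + i.2 : ℕ) : ℝ) ≤ ‖(i.1 : ℂ) * l₁ + i.2 * l₂ - l‖ := by
      generalize Finset.range N ×ˢ Finset.range N = s
      induction s using Finset.induction_on with
      | empty => exact ⟨1, one_pos, by simp⟩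
      | insert x s hx ih =>
        obtain ⟨c, hc, ih⟩ := ih
        by_cases hx2 : 2 ≤ x.1 + x.2
        · have hpos : 0 < ‖(x.1 : ℂ) * l₁ + x.2 * l₂ - l‖ :=
            norm_pos_iff.2 (sub_ne_zero.2 (hl _ _ hx2).symm)
          have hd : (0 : ℝ) < ((x.1 + x.2 : ℕ) : ℝ) := by exact_mod_cast (by omega : 0 < x.1 + x.2)
          refine ⟨min c (‖(x.1 : ℂ) * l₁ + x.2 * l₂ - l‖ / ((x.1 + x.2 : ℕ) : ℝ)),
            lt_min hc (div_pos hpos hd), fun i hi hi2 => ?_⟩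
          rcases Finset.mem_insert.1 hi with rfl | hi
          · refine (mul_le_mul_of_nonneg_right (min_le_right _ _) hd.le).trans ?_
            rw [div_mul_cancel₀ _ hd.ne']
          · exact (mul_le_mul_of_nonneg_right (min_le_left _ _) (by positivity)).trans (ih i hi hi2)
        · refine ⟨c, hc, fun i hi hi2 => ?_⟩
          rcases Finset.mem_insert.1 hi with rfl | hi
          · exact absurd hi2 hx2
          · exact ih i hi hi2
    obtain ⟨c, hc, hfin⟩ := hfin
    refine ⟨min c (δ / 2), lt_min hc (by linarith), fun n hn => ?_⟩
    by_cases hnN : n 0 < N ∧ n 1 < N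
    · refine (mul_le_mul_of_nonneg_right (min_le_left _ _) (by positivity)).trans ?_
      exact hfin (n 0, n 1) (by simpa using hnN) hn
    · refine (mul_le_mul_of_nonneg_right (min_le_right _ _) (by positivity)).trans ?_
      have h1 : (N : ℝ) ≤ deg n := by
        have : N ≤ deg n := by
          change N ≤ n 0 + n 1
          omega
        exact_mod_cast this
      have h2 := hlow n hn
      have h3 := norm_sub_norm_le ((n 0 : ℂ) * l₁ + (n 1 : ℂ) * l₂) l
      have h4 : δ * N ≤ δ * deg n := by gcongr
      change _ ≤ ‖(n 0 : ℂ) * l₁ + (n 1 : ℂ) * l₂ - l‖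
      linarith
  obtain ⟨c1, hc1, h1⟩ := key l₁ (fun i j h => (hN i j h).1)
  obtain ⟨c2, hc2, h2⟩ := key l₂ (fun i j h => (hN i j h).2)
  refine ⟨min c1 c2, lt_min hc1 hc2, fun n hn => ?_, fun n hn => ?_⟩
  · exact (mul_le_mul_of_nonneg_right (min_le_left _ _) (by positivity)).trans (h1 n hn)
  · exact (mul_le_mul_of_nonneg_right (min_le_right _ _) (by positivity)).trans (h2 n hn)
end PL

namespace PL
open Filter Topology

theorem local_inverse {Ψ : ℂ × ℂ → ℂ × ℂ} {B : Set (ℂ × ℂ)} (hB : IsOpen B) (h0 : (0 : ℂ × ℂ) ∈ B)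
    (hΨ0 : Ψ 0 = 0) (hΨ : ContDiffOn ℂ 1 Ψ B) {P : (ℂ × ℂ) ≃L[ℂ] (ℂ × ℂ)}
    (hP : HasFDerivAt Ψ (P : ℂ × ℂ →L[ℂ] ℂ × ℂ) 0) :
    ∃ (V W : Set (ℂ × ℂ)) (Φ : ℂ × ℂ → ℂ × ℂ), V ⊆ B ∧ IsOpen V ∧ IsOpen W ∧
      (0 : ℂ × ℂ) ∈ V ∧ (0 : ℂ × ℂ) ∈ W ∧ DifferentiableOn ℂ Ψ V ∧ DifferentiableOn ℂ Φ W ∧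
      Set.BijOn Ψ V W ∧ (∀ p ∈ V, Φ (Ψ p) = p) ∧ (∀ q ∈ W, Ψ (Φ q) = q) := by
  have hat : ContDiffAt ℂ 1 Ψ 0 := hΨ.contDiffAt (hB.mem_nhds h0)
  set e := hat.toOpenPartialHomeomorph Ψ hP one_ne_zero with he
  have hcoe : ∀ x, e x = Ψ x := fun x => rfl
  have hcoe' : (e : ℂ × ℂ → ℂ × ℂ) = Ψ := rfl
  have hs0 : (0 : ℂ × ℂ) ∈ e.source := hat.mem_toOpenPartialHomeomorph_source hP one_ne_zero
  have hinv : ContDiffAt ℂ 1 e.symm 0 := by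
    have := hat.to_localInverse hP one_ne_zero
    rw [hΨ0] at this
    exact this
  obtain ⟨W0, hW0, hW0o, hW00⟩ := eventually_nhds_iff.1 (hinv.eventually (by simp))
  have hVo : IsOpen (B ∩ (e.source ∩ e ⁻¹' W0)) := hB.inter (e.isOpen_inter_preimage hW0o)
  have hsub : B ∩ (e.source ∩ e ⁻¹' W0) ⊆ e.source := fun x hx => hx.2.1
  have h0V : (0 : ℂ × ℂ) ∈ B ∩ (e.source ∩ e ⁻¹' W0) :=
    ⟨h0, hs0, by change e 0 ∈ W0; rw [hcoe, hΨ0]; exact hW00⟩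
  refine ⟨B ∩ (e.source ∩ e ⁻¹' W0), e '' (B ∩ (e.source ∩ e ⁻¹' W0)), e.symm,
    Set.inter_subset_left, hVo, e.isOpen_image_of_subset_source hVo hsub, h0V,
    ⟨0, h0V, hΨ0⟩, ?_, ?_, ?_, ?_, ?_⟩
  · exact (hΨ.differentiableOn one_ne_zero).mono Set.inter_subset_left
  · rintro _ ⟨x, hx, rfl⟩
    exact ((hW0 _ hx.2.2).differentiableAt one_ne_zero).differentiableWithinAt
  · exact (e.injOn.mono hsub).bijOn_image
  · intro p hp
    exact e.left_inv (hsub hp)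
  · rintro _ ⟨x, hx, rfl⟩
    exact e.right_inv (e.map_source (hsub hx))

theorem conj_core {l₁ l₂ ε : ℂ} {c : ℝ} (hc : 0 < c) (hd1 : Div l₁ l₂ l₁ c)
    (hd2 : Div l₁ l₂ l₂ c) (hε : ‖ε‖ ≤ c / 8) {F : ℂ × ℂ → ℂ × ℂ} {U : Set (ℂ × ℂ)}
    (hU : IsOpen U) (h0 : (0 : ℂ × ℂ) ∈ U) (hF : DifferentiableOn ℂ F U) (hF0 : F 0 = 0)
    (P : (ℂ × ℂ) ≃L[ℂ] (ℂ × ℂ))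
    (hA1 : fderiv ℂ F 0 (P (1, 0)) = l₁ • P (1, 0))
    (hA2 : fderiv ℂ F 0 (P (0, 1)) = ε • P (1, 0) + l₂ • P (0, 1)) :
    ∃ (Ψ : ℂ × ℂ → ℂ × ℂ) (r : ℝ), 0 < r ∧ Ψ 0 = 0 ∧ ContDiffOn ℂ 1 Ψ (Metric.ball 0 r) ∧
      HasFDerivAt Ψ (P : ℂ × ℂ →L[ℂ] ℂ × ℂ) 0 ∧
      ∀ x ∈ Metric.ball (0 : ℂ × ℂ) r, fderiv ℂ Ψ x (l₁ * x.1 + ε * x.2, l₂ * x.2) = F (Ψ x) := by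
  have hD : HasFDerivAt F (fderiv ℂ F 0) 0 :=
    ((hF 0 h0).differentiableAt (hU.mem_nhds h0)).hasFDerivAt
  have hD' : HasFDerivAt (fun x => P.symm (F (P x)))
      ((P.symm : ℂ × ℂ →L[ℂ] ℂ × ℂ).comp ((fderiv ℂ F 0).comp (P : ℂ × ℂ →L[ℂ] ℂ × ℂ))) 0 := by
    have h1 : HasFDerivAt F (fderiv ℂ F 0) (P 0) := by rwa [map_zero]
    exact P.symm.hasFDerivAt.comp (0 : ℂ × ℂ) (h1.comp (0 : ℂ × ℂ) P.hasFDerivAt)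
  obtain ⟨Ψ, r, hr, hΨ0, hΨc, hΨd, hΨe⟩ := core_scaled hc hd1 hd2 hε
    (F := fun x => P.symm (F (P x))) (U := P ⁻¹' U) (hU.preimage P.continuous) (by simpa using h0)
    (fun x hx => (P.symm.differentiable.differentiableAt.comp_differentiableWithinAt x
      ((hF (P x) hx).comp x P.differentiable.differentiableAt.differentiableWithinAt
        (fun y hy => hy)))) (by simp [hF0])
    (by
      rw [hD'.fderiv]
      change P.symm (fderiv ℂ F 0 (P (1, 0))) = _
      rw [hA1, map_smul, P.symm_apply_apply]
      simp)
    (by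
      rw [hD'.fderiv]
      change P.symm (fderiv ℂ F 0 (P (0, 1))) = _
      rw [hA2, map_add, map_smul, map_smul, P.symm_apply_apply, P.symm_apply_apply]
      simp)
  refine ⟨fun x => P (Ψ x), r, hr, by simp [hΨ0], P.contDiff.comp_contDiffOn hΨc, ?_, ?_⟩
  · exact (P.hasFDerivAt.comp (0 : ℂ × ℂ) hΨd)
  · intro x hx
    have hdΨ : DifferentiableAt ℂ Ψ x :=
      ((hΨc.differentiableOn one_ne_zero) _ hx).differentiableAt (Metric.isOpen_ball.mem_nhds hx)
    have h1 : HasFDerivAt (fun x => P (Ψ x)) ((P : ℂ × ℂ →L[ℂ] ℂ × ℂ).comp (fderiv ℂ Ψ x)) x :=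
      P.hasFDerivAt.comp x hdΨ.hasFDerivAt
    rw [h1.fderiv]
    change P (fderiv ℂ Ψ x _) = _
    rw [hΨe x hx, P.apply_symm_apply]

theorem exists_equiv {v u : ℂ × ℂ} (h : LinearIndependent ℂ ![v, u]) :
    ∃ P : (ℂ × ℂ) ≃L[ℂ] (ℂ × ℂ), ∀ x, P x = x.1 • v + x.2 • u := by
  let f : ℂ × ℂ →ₗ[ℂ] ℂ × ℂ :=
    (LinearMap.fst ℂ ℂ ℂ).smulRight v + (LinearMap.snd ℂ ℂ ℂ).smulRight u
  have hf : ∀ x, f x = x.1 • v + x.2 • u := fun x => rfl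
  have hinj : Function.Injective f := by
    rw [injective_iff_map_eq_zero]
    intro x hx
    have := LinearIndependent.pair_iff.1 h x.1 x.2 (by rw [← hf, hx])
    exact Prod.ext this.1 this.2
  exact ⟨(LinearEquiv.ofInjectiveEndo f hinj).toContinuousLinearEquiv, hf⟩

theorem exists_triangular (A : ℂ × ℂ →ₗ[ℂ] ℂ × ℂ) {l₁ l₂ : ℂ}
    (hA : A.charpoly = (Polynomial.X - Polynomial.C l₁) * (Polynomial.X - Polynomial.C l₂)) :
    ∃ (v u : ℂ × ℂ) (s : ℂ), LinearIndependent ℂ ![v, u] ∧ A v = l₁ • v ∧ A u = s • v + l₂ • u := by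
  have hev : Module.End.HasEigenvalue A l₁ := by
    rw [Module.End.hasEigenvalue_iff_isRoot_charpoly, hA]
    simp
  obtain ⟨v, hv⟩ := hev.exists_hasEigenvector
  have hv1 : A v = l₁ • v := hv.apply_eq_smul
  obtain ⟨u, hu⟩ := exists_linearIndependent_pair_of_one_lt_finrank (R := ℂ) (M := ℂ × ℂ)
    (by simp) hv.2
  obtain ⟨P, hP⟩ := exists_equiv hu
  have hAu : A u = (P.symm (A u)).1 • v + (P.symm (A u)).2 • u := by
    rw [← hP, P.apply_symm_apply]
  generalize (P.symm (A u)).1 = s at hAu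
  generalize (P.symm (A u)).2 = t at hAu
  let b := basisOfLinearIndependentOfCardEqFinrank hu (by simp)
  have hb : (b : Fin 2 → ℂ × ℂ) = ![v, u] := coe_basisOfLinearIndependentOfCardEqFinrank _ _
  have hb0 : b 0 = v := by rw [hb]; rfl
  have hb1 : b 1 = u := by rw [hb]; rfl
  have hA0 : A (b 0) = l₁ • b 0 := by rw [hb0, hv1]
  have hA1 : A (b 1) = s • b 0 + t • b 1 := by rw [hb0, hb1, hAu]
  have hm : LinearMap.toMatrix b b A = !![l₁, s; 0, t] := by
    ext i j
    rw [LinearMap.toMatrix_apply]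
    fin_cases j <;> fin_cases i
    · simp [hA0]
    · simp [hA0]
    · simp [hA1]
    · simp [hA1]
  have hch := LinearMap.charpoly_toMatrix A b
  rw [hm, hA] at hch
  have h2 : (!![l₁, s; 0, t] : Matrix (Fin 2) (Fin 2) ℂ).charpoly =
      (Polynomial.X - Polynomial.C l₁) * (Polynomial.X - Polynomial.C t) := by
    rw [Matrix.charpoly_fin_two]
    simp [Matrix.trace_fin_two, Matrix.det_fin_two]
    ring
  rw [h2] at hch
  have h3 := mul_left_cancel₀ (Polynomial.X_sub_C_ne_zero l₁) hch
  have h4 : t = l₂ := by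
    have := congrArg (Polynomial.eval t) h3
    simp at this
    linear_combination -this
  exact ⟨v, u, s, hu, hv1, by rw [hAu, h4]⟩
end PL

/-- Poincaré linearization in ℂ².  A holomorphic vector field with
nonresonant Poincaré spectrum at the equilibrium `0` is locally biholomorphically
conjugate to its linearization; in the semisimple case the linear model may be
taken diagonal. -/
theorem poincare_linearization
    (F : ℂ × ℂ → ℂ × ℂ) (U : Set (ℂ × ℂ)) (hU : IsOpen U) (h0U : (0, 0) ∈ U)
    (hF : DifferentiableOn ℂ F U) (hF0 : F (0, 0) = (0, 0))
    (lam₁ lam₂ : ℂ) (hlam₁ : lam₁ ≠ 0) (hlam₂ : lam₂ ≠ 0)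
    (hchar : ((fderiv ℂ F (0, 0)).toLinearMap).charpoly =
      (Polynomial.X - Polynomial.C lam₁) * (Polynomial.X - Polynomial.C lam₂))
    (hP : PoincareDomain lam₁ lam₂) (hNR : ¬ Resonant lam₁ lam₂) :
    (∃ (V W : Set (ℂ × ℂ)) (Ψ Φ : ℂ × ℂ → ℂ × ℂ),
      IsOpen V ∧ IsOpen W ∧ (0, 0) ∈ V ∧ (0, 0) ∈ W ∧
      DifferentiableOn ℂ Ψ V ∧ DifferentiableOn ℂ Φ W ∧
      Set.BijOn Ψ V W ∧ (∀ p ∈ V, Φ (Ψ p) = p) ∧ (∀ q ∈ W, Ψ (Φ q) = q) ∧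
      Ψ (0, 0) = (0, 0) ∧ fderiv ℂ Ψ (0, 0) = ContinuousLinearMap.id ℂ (ℂ × ℂ) ∧
      (∀ p ∈ V, fderiv ℂ Ψ p (fderiv ℂ F (0, 0) p) = F (Ψ p))) ∧
    ((∃ v₁ v₂ : ℂ × ℂ, LinearIndependent ℂ ![v₁, v₂] ∧
        fderiv ℂ F (0, 0) v₁ = lam₁ • v₁ ∧ fderiv ℂ F (0, 0) v₂ = lam₂ • v₂) →
      ∃ (V W : Set (ℂ × ℂ)) (Ψ Φ : ℂ × ℂ → ℂ × ℂ),
        IsOpen V ∧ IsOpen W ∧ (0, 0) ∈ V ∧ (0, 0) ∈ W ∧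
        DifferentiableOn ℂ Ψ V ∧ DifferentiableOn ℂ Φ W ∧
        Set.BijOn Ψ V W ∧ (∀ p ∈ V, Φ (Ψ p) = p) ∧ (∀ q ∈ W, Ψ (Φ q) = q) ∧
        Ψ (0, 0) = (0, 0) ∧
        (∀ p ∈ V, fderiv ℂ Ψ p (lam₁ * p.1, lam₂ * p.2) = F (Ψ p))) := by
  rw [Prod.mk_zero_zero] at *
  obtain ⟨c, hc, hd1, hd2⟩ := PL.exists_div hP (fun i j hij =>
    ⟨fun h => hNR ⟨i, j, hij, Or.inl h⟩, fun h => hNR ⟨i, j, hij, Or.inr h⟩⟩)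
  constructor
  · obtain ⟨v, u, s, hvu, hAv, hAu⟩ := PL.exists_triangular _ hchar
    have hη0 : (0 : ℝ) < c / 8 / (‖s‖ + 1) := by positivity
    have hηs : ‖((c / 8 / (‖s‖ + 1) : ℝ) : ℂ) * s‖ ≤ c / 8 := by
      rw [norm_mul, Complex.norm_real, Real.norm_of_nonneg hη0.le, div_mul_eq_mul_div,
        div_le_iff₀ (by positivity)]
      nlinarith [norm_nonneg s]
    have hη : ((c / 8 / (‖s‖ + 1) : ℝ) : ℂ) ≠ 0 := by exact_mod_cast hη0.ne'
    generalize ((c / 8 / (‖s‖ + 1) : ℝ) : ℂ) = η at hηs hη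
    have hvu' : LinearIndependent ℂ ![v, η • u] := by
      rw [LinearIndependent.pair_iff] at hvu ⊢
      intro a b hab
      rw [smul_smul] at hab
      obtain ⟨h1, h2⟩ := hvu a (b * η) hab
      exact ⟨h1, (mul_eq_zero.1 h2).resolve_right hη⟩
    obtain ⟨P, hPx⟩ := PL.exists_equiv hvu'
    have hP1 : P (1, 0) = v := by rw [hPx]; simp
    have hP2 : P (0, 1) = η • u := by rw [hPx]; simp
    have hA1 : fderiv ℂ F 0 (P (1, 0)) = lam₁ • P (1, 0) := by rw [hP1]; exact hAv
    have hA2 : fderiv ℂ F 0 (P (0, 1)) = (η * s) • P (1, 0) + lam₂ • P (0, 1) := by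
      have hAu' : fderiv ℂ F 0 u = s • v + lam₂ • u := hAu
      rw [hP1, hP2, map_smul, hAu', smul_add, smul_smul, smul_smul, smul_smul, mul_comm η lam₂]
    obtain ⟨Ψ, r, hr, hΨ0, hΨc, hΨd, hΨe⟩ :=
      PL.conj_core hc hd1 hd2 hηs hU h0U hF hF0 P hA1 hA2
    have hAP : ∀ x, P.symm (fderiv ℂ F 0 (P x)) =
        (lam₁ * x.1 + (η * s) * x.2, lam₂ * x.2) := by
      intro x
      have hx : P x = x.1 • P (1, 0) + x.2 • P (0, 1) := by rw [hP1, hP2, hPx]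
      rw [ContinuousLinearEquiv.symm_apply_eq, hx, map_add, map_smul, map_smul, hA1, hA2]
      have hy : ∀ a b : ℂ, P (a, b) = a • P (1, 0) + b • P (0, 1) := fun a b => by
        rw [hP1, hP2, hPx]
      rw [hy (lam₁ * x.1 + η * s * x.2)]
      module
    have hder : ∀ p L, HasFDerivAt Ψ L (P.symm p) →
        HasFDerivAt (fun p => Ψ (P.symm p)) (L.comp (P.symm : ℂ × ℂ →L[ℂ] ℂ × ℂ)) p :=
      fun p L hL => hL.comp p P.symm.hasFDerivAt
    have hid : HasFDerivAt (fun p => Ψ (P.symm p)) (ContinuousLinearMap.id ℂ (ℂ × ℂ)) 0 := by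
      refine (hder 0 _ (by rw [map_zero]; exact hΨd)).congr_fderiv
        (ContinuousLinearMap.ext fun v => ?_)
      exact P.apply_symm_apply v
    obtain ⟨V, W, Φ, hVB, hV, hW, h0V, h0W, hdΨ, hdΦ, hbij, hl, hrr⟩ :=
      PL.local_inverse (Ψ := fun p => Ψ (P.symm p)) (B := P.symm ⁻¹' Metric.ball 0 r)
        (Metric.isOpen_ball.preimage P.symm.continuous) (by simpa using hr) (by simp [hΨ0])
        (hΨc.comp P.symm.contDiff.contDiffOn (fun x hx => hx))
        (P := ContinuousLinearEquiv.refl ℂ (ℂ × ℂ)) hid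
    refine ⟨V, W, fun p => Ψ (P.symm p), Φ, hV, hW, h0V, h0W, hdΨ, hdΦ, hbij, hl, hrr,
      by simp [hΨ0], hid.fderiv, fun p hp => ?_⟩
    have hpB : P.symm p ∈ Metric.ball (0 : ℂ × ℂ) r := hVB hp
    have hd : DifferentiableAt ℂ Ψ (P.symm p) :=
      ((hΨc.differentiableOn one_ne_zero) _ hpB).differentiableAt (Metric.isOpen_ball.mem_nhds hpB)
    rw [(hder p _ hd.hasFDerivAt).fderiv]
    have h1 := hAP (P.symm p)
    rw [P.apply_symm_apply] at h1
    change fderiv ℂ Ψ (P.symm p) (P.symm (fderiv ℂ F 0 p)) = F (Ψ (P.symm p))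
    rw [h1]
    exact hΨe _ hpB
  · rintro ⟨v₁, v₂, hv, hA1, hA2⟩
    obtain ⟨P, hPx⟩ := PL.exists_equiv hv
    have hP1 : P (1, 0) = v₁ := by rw [hPx]; simp
    have hP2 : P (0, 1) = v₂ := by rw [hPx]; simp
    obtain ⟨Ψ, r, hr, hΨ0, hΨc, hΨd, hΨe⟩ :=
      PL.conj_core hc hd1 hd2 (ε := 0) (by rw [norm_zero]; positivity) hU h0U hF hF0 P
        (by rw [hP1, hA1]) (by rw [hP2, hA2, zero_smul, zero_add])
    obtain ⟨V, W, Φ, hVB, hV, hW, h0V, h0W, hdΨ, hdΦ, hbij, hl, hrr⟩ :=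
      PL.local_inverse Metric.isOpen_ball (Metric.mem_ball_self hr) hΨ0 hΨc hΨd
    refine ⟨V, W, Ψ, Φ, hV, hW, h0V, h0W, hdΨ, hdΦ, hbij, hl, hrr, hΨ0, fun p hp => ?_⟩
    have := hΨe p (hVB hp)
    rwa [zero_mul, add_zero] at this
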